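/- arXiv:2512.20442 — 6 statements merged into one kernel-verified Lean document; each statement's English description precedes it below -/
import Mathlib

section
/- Let P be a finite nonempty poset with m elements and let k ≥ 1 be an integer. Then k! · c_k(P) equals the sum, over all strictly increasing chains ∅ = I_0 ⊊ I_1 ⊊ ⋯ ⊊ I_k = P of order ideals of P, of the product Π_{j=1}^{k} c_1(I_j \ I_{j−1}), where each set difference I_j \ I_{j−1} is regarded as a poset with the partial order induced from P. -/
open Polynomial

section helpers
open Classical
variable {P : Type*} [Fintype P] [PartialOrder P]

def OPLow (T : Finset P) : Prop := ∀ x ∈ T, ∀ y : P, y ≤ x → y ∈ T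

noncomputable def opCnt (T : Finset P) (t : ℕ) : ℕ :=
  Nat.card {f : {x // x ∈ T} → Fin t // Monotone f}

noncomputable def opIdeals (T : Finset P) : Finset (Finset P) :=
  T.powerset.filter OPLow

noncomputable def opLev {T : Finset P} {s t : ℕ} (f : {x // x ∈ T} → Fin (s + t)) : Finset P :=
  T.filter (fun x => ∃ h : x ∈ T, (f ⟨x, h⟩ : ℕ) < s)

theorem opLev_mem {T : Finset P} {s t : ℕ} (f : {x // x ∈ T} → Fin (s + t)) (x : P) (h : x ∈ T) :
    x ∈ opLev f ↔ (f ⟨x, h⟩ : ℕ) < s := by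
  simp [opLev, h]

theorem opFiber (T I : Finset P) (hI : I ⊆ T) (hIl : OPLow I) (s t : ℕ) :
    Fintype.card {f : {f : {x // x ∈ T} → Fin (s + t) // Monotone f} // opLev f.1 = I}
      = opCnt I s * opCnt (T \ I) t := by
  unfold opCnt
  rw [← Nat.card_prod, ← Nat.card_eq_fintype_card]
  apply Nat.card_congr
  have hlt : ∀ (f : {f : {f : {x // x ∈ T} → Fin (s + t) // Monotone f} // opLev f.1 = I})
      (x : P) (h : x ∈ T), x ∈ I ↔ (f.1.1 ⟨x, h⟩ : ℕ) < s := by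
    intro f x h
    rw [← opLev_mem, f.2]
  have hmemT : ∀ x, x ∈ T \ I → x ∈ T := fun x h => (Finset.mem_sdiff.1 h).1
  have hnI : ∀ x, x ∈ T \ I → x ∉ I := fun x h => (Finset.mem_sdiff.1 h).2
  refine
    { toFun := fun f =>
        (⟨fun x => ⟨f.1.1 ⟨x.1, hI x.2⟩, (hlt f x.1 (hI x.2)).1 x.2⟩, ?_⟩,
         ⟨fun x => ⟨(f.1.1 ⟨x.1, hmemT _ x.2⟩ : ℕ) - s, ?_⟩, ?_⟩)
      invFun := fun p =>
        ⟨⟨fun x => if h : x.1 ∈ I then ⟨p.1.1 ⟨x.1, h⟩, ?_⟩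
          else ⟨s + p.2.1 ⟨x.1, Finset.mem_sdiff.2 ⟨x.2, h⟩⟩, ?_⟩, ?_⟩, ?_⟩
      left_inv := ?_
      right_inv := ?_ }
  · intro x y hxy
    exact f.1.2 (show (⟨x.1, hI x.2⟩ : {x // x ∈ T}) ≤ ⟨y.1, hI y.2⟩ from hxy)
  · have h1 := (f.1.1 ⟨x.1, hmemT _ x.2⟩).2
    have h2 := mt (hlt f x.1 (hmemT _ x.2)).2 (hnI _ x.2)
    omega
  · intro x y hxy
    have := f.1.2 (show (⟨x.1, hmemT _ x.2⟩ : {x // x ∈ T}) ≤ ⟨y.1, hmemT _ y.2⟩ from hxy)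
    exact Nat.sub_le_sub_right this s
  · exact lt_of_lt_of_le (p.1.1 ⟨x.1, h⟩).2 (Nat.le_add_right _ _)
  · have := (p.2.1 ⟨x.1, Finset.mem_sdiff.2 ⟨x.2, h⟩⟩).2
    omega
  · intro x y hxy
    by_cases hy : y.1 ∈ I
    · have hx : x.1 ∈ I := hIl _ hy _ hxy
      simp only [hx, hy, dif_pos]
      exact p.1.2 (show (⟨x.1, hx⟩ : {x // x ∈ I}) ≤ ⟨y.1, hy⟩ from hxy)
    · by_cases hx : x.1 ∈ I
      · simp only [hx, hy, dif_pos, dif_neg, not_false_eq_true]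
        show (p.1.1 ⟨x.1, hx⟩ : ℕ) ≤ _
        exact le_trans (p.1.1 ⟨x.1, hx⟩).2.le (Nat.le_add_right _ _)
      · simp only [hx, hy, dif_neg, not_false_eq_true]
        have := p.2.2 (show (⟨x.1, Finset.mem_sdiff.2 ⟨x.2, hx⟩⟩ : {x // x ∈ T \ I}) ≤
          ⟨y.1, Finset.mem_sdiff.2 ⟨y.2, hy⟩⟩ from hxy)
        exact Nat.add_le_add_left this s
  · ext x
    by_cases hT : x ∈ T
    · rw [opLev_mem _ x hT]
      by_cases hx : x ∈ I
      · simp [hx]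
      · simp [hx]
    · have h1 : x ∉ I := fun h => hT (hI h)
      simp [opLev, hT, h1]
  · intro f
    apply Subtype.ext
    apply Subtype.ext
    funext x
    by_cases hx : x.1 ∈ I
    · simp [hx]
    · have h2 := mt (hlt f x.1 x.2).2 hx
      simp only [hx, dif_neg, not_false_eq_true]
      apply Fin.ext
      show s + ((f.1.1 x : ℕ) - s) = f.1.1 x
      have : ¬ (f.1.1 x : ℕ) < s := h2
      omega
  · rintro ⟨a, b⟩
    apply Prod.ext
    · apply Subtype.ext
      funext x
      apply Fin.ext
      simp [x.2]
    · apply Subtype.ext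
      funext x
      apply Fin.ext
      simp [hnI _ x.2]

theorem opCnt_add (T : Finset P) (hT : OPLow T) (s t : ℕ) :
    opCnt T (s + t) = ∑ I ∈ opIdeals T, opCnt I s * opCnt (T \ I) t := by
  have h0 : opCnt T (s + t) =
      (Finset.univ : Finset {f : {x // x ∈ T} → Fin (s + t) // Monotone f}).card := by
    unfold opCnt; rw [Nat.card_eq_fintype_card]; rfl
  rw [h0, Finset.card_eq_sum_card_fiberwise (f := fun f => opLev f.1) (t := opIdeals T)]
  · refine Finset.sum_congr rfl fun I hI => ?_
    simp only [opIdeals, Finset.mem_filter, Finset.mem_powerset] at hI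
    rw [← opFiber T I hI.1 hI.2, Fintype.card_subtype]
  · intro f _
    simp only [opIdeals, Finset.coe_filter, Set.mem_ofPred_eq, Finset.mem_powerset]
    refine ⟨Finset.filter_subset _ _, ?_⟩
    intro x hx y hy
    have hxT : x ∈ T := (Finset.mem_filter.1 hx).1
    have hyT := hT x hxT y hy
    rw [opLev_mem _ _ hxT] at hx
    rw [opLev_mem _ _ hyT]
    exact lt_of_le_of_lt (f.2 (show (⟨y, hyT⟩ : {x // x ∈ T}) ≤ ⟨x, hxT⟩ from hy)) hx

theorem op_poly_eq (p q : ℚ[X]) (h : ∀ t : ℕ, 0 < t → p.eval (t : ℚ) = q.eval (t : ℚ)) :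
    p = q := by
  apply Polynomial.eq_of_infinite_eval_eq
  apply Set.Infinite.mono (s := Set.range (fun n : ℕ => ((n + 1 : ℕ) : ℚ)))
  · rintro _ ⟨n, rfl⟩
    exact h _ n.succ_pos
  · apply Set.infinite_range_of_injective
    intro a b hab
    simpa using hab

variable (Ω : Finset P → ℚ[X])
    (hΩ : ∀ T : Finset P, ∀ t : ℕ, 0 < t → (Ω T).eval (t : ℚ) = (opCnt T t : ℚ))
include hΩ

theorem op_shift (T : Finset P) (hT : OPLow T) (s : ℕ) (hs : 0 < s) :
    (Ω T).comp (X + C (s : ℚ)) = ∑ I ∈ opIdeals T, C ((Ω I).eval (s : ℚ)) * Ω (T \ I) := by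
  apply op_poly_eq
  intro t ht
  have h1 := hΩ T (s + t) (by omega)
  rw [opCnt_add T hT] at h1
  simp only [eval_comp, eval_add, eval_X, eval_C, eval_finsetSum, eval_mul]
  push_cast at h1
  rw [add_comm, h1]
  exact Finset.sum_congr rfl fun I _ => by rw [hΩ _ _ hs, hΩ _ _ ht]

theorem op_zero (T : Finset P) (hT : OPLow T) :
    Ω T = ∑ I ∈ opIdeals T, C ((Ω (T \ I)).coeff 0) * Ω I := by
  apply op_poly_eq
  intro s hs
  have := congrArg (eval 0) (op_shift Ω hΩ T hT s hs)
  simp only [eval_comp, eval_add, eval_X, eval_C, eval_finsetSum, eval_mul, zero_add] at this ⊢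
  rw [this]
  exact Finset.sum_congr rfl fun I _ => by rw [coeff_zero_eq_eval_zero, mul_comm]

theorem op_deriv (T : Finset P) (hT : OPLow T) :
    derivative (Ω T) = ∑ I ∈ opIdeals T, C ((Ω (T \ I)).coeff 1) * Ω I := by
  apply op_poly_eq
  intro s hs
  have := congrArg (fun p => eval 0 (derivative p)) (op_shift Ω hΩ T hT s hs)
  have e : ∀ p : ℚ[X], eval 0 (derivative p) = p.coeff 1 := by
    intro p
    rw [← coeff_zero_eq_eval_zero, coeff_derivative]; simp
  simp only [e, finsetSum_coeff, coeff_C_mul] at this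
  simp only [← e, eval_finsetSum, eval_mul, eval_C] at this ⊢
  rw [derivative_comp] at this
  simp at this
  rw [this]
  exact Finset.sum_congr rfl fun I _ => by rw [mul_comm]

theorem op_empty : Ω ∅ = 1 := by
  apply op_poly_eq
  intro t ht
  rw [hΩ _ _ ht, opCnt]
  have : Nat.card {f : {x // x ∈ (∅ : Finset P)} → Fin t // Monotone f} = 1 := by
    rw [Nat.card_eq_one_iff_unique]
    refine ⟨⟨fun a b => ?_⟩, ⟨⟨fun x => absurd x.2 (Finset.notMem_empty _), fun x => absurd x.2 (Finset.notMem_empty _)⟩⟩⟩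
    apply Subtype.ext
    funext x
    exact absurd x.2 (Finset.notMem_empty _)
  rw [this]; simp

theorem op_c0 (n : ℕ) : ∀ T : Finset P, T.card = n → OPLow T → T.Nonempty →
    (Ω T).coeff 0 = 0 := by
  induction n using Nat.strong_induction_on with
  | _ n ih =>
    intro T hn hT hne
    have h := congrArg (fun p => coeff p 0) (op_zero Ω hΩ T hT)
    simp only [finsetSum_coeff, coeff_C_mul] at h
    have hsub : ({∅, T} : Finset (Finset P)) ⊆ opIdeals T := by
      intro I hI
      simp only [Finset.mem_insert, Finset.mem_singleton] at hI
      rcases hI with rfl | rfl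
      · simp [opIdeals, OPLow]
      · simp [opIdeals, hT]
    rw [← Finset.sum_subset hsub, Finset.sum_pair hne.ne_empty.symm] at h
    · simp [op_empty Ω hΩ] at h
      exact h
    · intro I hI hI2
      simp only [opIdeals, Finset.mem_filter, Finset.mem_powerset] at hI
      simp only [Finset.mem_insert, Finset.mem_singleton, not_or] at hI2
      have hlt : I.card < n := by
        rw [← hn]
        exact Finset.card_lt_card (Finset.ssubset_iff_subset_ne.2 ⟨hI.1, hI2.2⟩)
      rw [ih _ hlt I rfl hI.2 (Finset.nonempty_iff_ne_empty.2 hI2.1), mul_zero]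

noncomputable def opChains (k : ℕ) (T : Finset P) : Finset (Fin (k + 1) → Finset P) :=
  Finset.univ.filter fun S => S 0 = ∅ ∧ S (Fin.last k) = T ∧ StrictMono S ∧ ∀ i, OPLow (S i)

omit hΩ in
theorem mem_opChains (k : ℕ) (T : Finset P) (S : Fin (k + 1) → Finset P) :
    S ∈ opChains k T ↔ S 0 = ∅ ∧ S (Fin.last k) = T ∧ StrictMono S ∧ ∀ i, OPLow (S i) := by
  simp only [opChains, Finset.mem_filter, Finset.mem_univ, true_and]

theorem op_main (k : ℕ) : ∀ T : Finset P, OPLow T →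
    (k.factorial : ℚ) * (Ω T).coeff k =
      ∑ S ∈ opChains k T, ∏ j : Fin k, (Ω (S j.succ \ S j.castSucc)).coeff 1 := by
  induction k with
  | zero =>
    intro T hT
    rcases T.eq_empty_or_nonempty with rfl | hne
    · rw [op_empty Ω hΩ]
      have : opChains 0 (∅ : Finset P) = {fun _ => ∅} := by
        ext S
        simp only [opChains, Finset.mem_filter, Finset.mem_univ, true_and, Finset.mem_singleton]
        constructor
        · rintro ⟨h, -⟩
          funext i
          rw [show i = 0 from Fin.fin_one_eq_zero i, h]
        · rintro rfl
          exact ⟨rfl, rfl, fun a b hab => absurd ((Fin.fin_one_eq_zero a).trans (Fin.fin_one_eq_zero b).symm) hab.ne, fun i => hT⟩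
      rw [this]; simp
    · rw [op_c0 Ω hΩ _ T rfl hT hne, mul_zero, Finset.sum_eq_zero]
      intro S hS
      simp only [opChains, Finset.mem_filter, Finset.mem_univ, true_and] at hS
      exact absurd (hS.2.1.symm.trans hS.1) hne.ne_empty
  | succ k ih =>
    intro T hT
    have h := congrArg (fun p => coeff p k) (op_deriv Ω hΩ T hT)
    simp only [finsetSum_coeff, coeff_C_mul, coeff_derivative] at h
    have h2 : ((k + 1).factorial : ℚ) * (Ω T).coeff (k + 1) =
        ∑ I ∈ opIdeals T, (Ω (T \ I)).coeff 1 * ((k.factorial : ℚ) * (Ω I).coeff k) := by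
      rw [Nat.factorial_succ]
      push_cast
      calc _ = (k.factorial : ℚ) * ((Ω T).coeff (k + 1) * (k + 1)) := by ring
        _ = _ := by
          rw [h, Finset.mul_sum]
          exact Finset.sum_congr rfl fun I _ => by ring
    rw [h2, ← Finset.sum_fiberwise_of_maps_to (s := opChains (k + 1) T) (t := opIdeals T)
      (g := fun S => S (Fin.last k).castSucc)]
    · refine Finset.sum_congr rfl fun I hI => ?_
      simp only [opIdeals, Finset.mem_filter, Finset.mem_powerset] at hI
      rw [ih I hI.2]
      by_cases hIT : I = T
      · subst hIT
        rw [Finset.sdiff_self, op_empty Ω hΩ, Finset.sum_eq_zero (s := Finset.filter _ _)]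
        · simp [coeff_one]
        · intro S hS
          simp only [opChains, Finset.mem_filter, Finset.mem_univ, true_and] at hS
          obtain ⟨⟨h0, h1, h3, h4⟩, h5⟩ := hS
          exact absurd (h5.trans h1.symm) (h3 (Fin.castSucc_lt_last _)).ne
      · have hss : I < T := lt_of_le_of_ne hI.1 hIT
        rw [Finset.mul_sum]
        refine Finset.sum_bij' (fun S _ => Fin.snoc (α := fun _ => Finset P) S T)
          (fun S _ => fun i => S i.castSucc) ?_ ?_ ?_ ?_ ?_
        · intro S hS
          simp only [opChains, Finset.mem_filter, Finset.mem_univ, true_and] at hS ⊢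
          obtain ⟨h0, h1, h3, h4⟩ := hS
          refine ⟨⟨?_, ?_, ?_, ?_⟩, ?_⟩
          · rw [← Fin.castSucc_zero, Fin.snoc_castSucc, h0]
          · rw [Fin.snoc_last]
          · rw [Fin.strictMono_iff_lt_succ]
            intro i
            rw [Fin.snoc_castSucc]
            induction i using Fin.lastCases with
            | last => rw [Fin.succ_last, Fin.snoc_last, h1]; exact hss
            | cast i => 
              rw [Fin.succ_castSucc, Fin.snoc_castSucc]
              exact h3 (Fin.castSucc_lt_succ)
          · intro i
            induction i using Fin.lastCases with
            | last => rw [Fin.snoc_last]; exact hT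
            | cast i => rw [Fin.snoc_castSucc]; exact h4 i
          · rw [Fin.snoc_castSucc, h1]
        · intro S hS
          simp only [opChains, Finset.mem_filter, Finset.mem_univ, true_and] at hS ⊢
          obtain ⟨⟨h0, h1, h3, h4⟩, h5⟩ := hS
          exact ⟨h0, h5, fun a b hab => h3 (Fin.castSucc_lt_castSucc_iff.2 hab), fun i => h4 _⟩
        · intro S hS
          funext i
          simp only [Fin.snoc_castSucc]
        · intro S hS
          simp only [opChains, Finset.mem_filter, Finset.mem_univ, true_and] at hS
          funext i
          induction i using Fin.lastCases with
          | last => rw [Fin.snoc_last, hS.1.2.1]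
          | cast i => rw [Fin.snoc_castSucc]
        · intro S hS
          simp only [opChains, Finset.mem_filter, Finset.mem_univ, true_and] at hS
          rw [Fin.prod_univ_castSucc, mul_comm]
          simp only [Fin.succ_castSucc, Fin.snoc_castSucc, Fin.succ_last, Fin.snoc_last, hS.2.1]
    · intro S hS
      simp only [opChains, Finset.mem_filter, Finset.mem_univ, true_and] at hS
      simp only [opIdeals, Finset.mem_filter, Finset.mem_powerset]
      refine ⟨?_, hS.2.2.2 _⟩
      rw [← hS.2.1]
      exact (hS.2.2.1 (Fin.castSucc_lt_last _)).le

end helpers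

/-- For a finite nonempty poset `P` with `m` elements and `k ≥ 1`,
`k! · c_k(P)` equals the sum over strictly increasing chains
`∅ = I_0 ⊊ I_1 ⊊ ⋯ ⊊ I_k = P` of order ideals of `P` of the products
`Π_{j=1}^k c_1(I_j \ I_{j-1})`, where each difference carries the induced order.
Here `Ω T` denotes the order polynomial of the subposet induced on the finset `T`,
characterized by its values at positive integers, and `c_k = coeff k`. -/
theorem order_poly_coeff_chain_formula
    {P : Type*} [Fintype P] [PartialOrder P] [Nonempty P] [DecidableEq P]
    (m k : ℕ) (hm : Fintype.card P = m) (hk : 1 ≤ k)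
    (Ω : Finset P → Polynomial ℚ)
    (hΩ : ∀ T : Finset P, ∀ t : ℕ, 0 < t →
      (Ω T).eval (t : ℚ) = (Nat.card {f : {x // x ∈ T} → Fin t // Monotone f} : ℚ)) :
    (k.factorial : ℚ) * (Ω Finset.univ).coeff k =
      ∑ᶠ S ∈ {S : Fin (k + 1) → Finset P |
          S 0 = ∅ ∧ S (Fin.last k) = Finset.univ ∧ StrictMono S ∧
          ∀ i : Fin (k + 1), ∀ x ∈ S i, ∀ y : P, y ≤ x → y ∈ S i},
        ∏ j : Fin k, (Ω (S j.succ \ S j.castSucc)).coeff 1 := by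
  have key := op_main Ω hΩ k Finset.univ (fun _ _ _ _ => Finset.mem_univ _)
  rw [finsum_mem_eq_finite_toFinset_sum _ (Set.toFinite _)]
  convert key using 1
  apply Finset.sum_congr
  · ext S
    rw [Set.Finite.mem_toFinset, mem_opChains]
    rfl
  · intro S _
    refine Finset.prod_congr rfl fun j _ => ?_
    congr!
end

section
/- For every integer k ≥ 1 the following identities hold in Q[t]: Ω(Z_{2k+1};t) = (−1)^k · binom(t+k, 2k+1) + Σ_{i=1}^{k} (−1)^{i+1} · binom(t+i, 2i) · Ω(Z_{2(k−i)+1};t), and Ω(Z_{2k};t) = Σ_{i=1}^{k} (−1)^{i+1} · binom(t+i, 2i) · Ω(Z_{2(k−i)};t), where binom(t+i, m) denotes the polynomial (t+i)(t+i−1)⋯(t+i−m+1)/m! in Q[t], and by convention Ω(Z_0;t) := 1 and Ω(Z_1;t) = t. -/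
open Polynomial

/-- Order-preserving condition for maps from the zigzag poset `Z_n`
(on elements `z_1, …, z_n`, order generated by `z_{2i} < z_{2i-1}` and
`z_{2i} < z_{2i+1}`) to the chain `{1, …, t}`; in 0-based indexing the
elements with odd index are minimal. -/
def ZigzagMono (n t : ℕ) (f : Fin n → Fin t) : Prop :=
  ∀ j : ℕ, (h : j + 1 < n) →
    if Odd j then f ⟨j, Nat.lt_of_succ_lt h⟩ ≤ f ⟨j + 1, h⟩
    else f ⟨j + 1, h⟩ ≤ f ⟨j, Nat.lt_of_succ_lt h⟩

/-- The polynomial `binom(t+i, m) = (t+i)(t+i-1)⋯(t+i-m+1)/m!` in `ℚ[t]`. -/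
noncomputable def binomPoly (i m : ℕ) : Polynomial ℚ :=
  Polynomial.C (1 / (m.factorial : ℚ)) *
    ∏ j ∈ Finset.range m, (Polynomial.X + Polynomial.C ((i : ℚ) - (j : ℚ)))

/-- the relation between positions `b` and `b+1` -/
def zrel (b x y : ℕ) : Prop := if Odd b then x ≤ y else y ≤ x

instance (b x y : ℕ) : Decidable (zrel b x y) := by unfold zrel; infer_instance

def ZigB (b n t : ℕ) (f : Fin n → Fin t) : Prop :=
  ∀ j : ℕ, (h : j + 1 < n) → zrel (j + b) (f ⟨j, Nat.lt_of_succ_lt h⟩) (f ⟨j + 1, h⟩)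

def zD (t : ℕ) : ℕ → ℕ → ℕ → ℚ
  | _, 0, _ => 1
  | b, n + 1, x => ∑ y ∈ Finset.range t, if zrel b x y then zD t (b + 1) n y else 0

theorem zigB_zero (n t : ℕ) (f : Fin n → Fin t) : ZigzagMono n t f ↔ ZigB 0 n t f := by
  unfold ZigzagMono ZigB zrel
  simp

theorem zigB_cons (b n t : ℕ) (x y : Fin t) (f : Fin n → Fin t) :
    ZigB b (n + 2) t (Fin.cons x (Fin.cons y f : Fin (n + 1) → Fin t)) ↔
      zrel b x y ∧ ZigB (b + 1) (n + 1) t (Fin.cons y f) := by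
  constructor
  · intro h
    refine ⟨by simpa using h 0 (by omega), ?_⟩
    intro j hj
    have := h (j + 1) (by omega)
    rw [show j + 1 + b = j + (b + 1) by ring] at this
    exact this
  · rintro ⟨h0, h⟩ j hj
    rcases j with _ | j
    · simpa using h0
    · have := h j (by omega)
      rw [show j + (b + 1) = j + 1 + b by ring] at this
      exact this

open Classical in
theorem zD_count (t n : ℕ) : ∀ (b : ℕ) (x : Fin t),
    (∑ f : Fin n → Fin t, if ZigB b (n + 1) t (Fin.cons x f) then (1 : ℚ) else 0) = zD t b n x := by
  induction n with
  | zero =>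
    intro b x
    have : ∀ f : Fin 0 → Fin t, ZigB b (0 + 1) t (Fin.cons x f) := by
      intro f j hj; omega
    simp [this, zD]
  | succ n ih =>
    intro b x
    rw [← Equiv.sum_comp (Fin.consEquiv (fun _ : Fin (n + 1) => Fin t)), Fintype.sum_prod_type]
    simp only [zD]
    rw [← Fin.sum_univ_eq_sum_range (fun y => if zrel b x y then zD t (b + 1) n y else 0)]
    refine Finset.sum_congr rfl fun y _ => ?_
    rw [← ih]
    simp only [Fin.consEquiv, Equiv.coe_fn_mk]
    by_cases h : zrel b x y
    · rw [if_pos h]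
      refine Finset.sum_congr rfl fun f _ => ?_
      have := zigB_cons b n t x y f
      simp only [h, true_and] at this
      exact if_congr this rfl rfl
    · rw [if_neg h]
      refine Finset.sum_eq_zero fun f _ => ?_
      exact if_neg (fun h' => h ((zigB_cons b n t x y f).1 h').1)

noncomputable def zW (t n : ℕ) : ℚ := (Nat.card {f : Fin n → Fin t // ZigzagMono n t f} : ℚ)

theorem zW_zero (t : ℕ) : zW t 0 = 1 := by
  have : ∀ f : Fin 0 → Fin t, ZigzagMono 0 t f := by
    intro f j hj; omega
  simp [zW, this]

theorem zW_succ (t n : ℕ) : zW t (n + 1) = ∑ x ∈ Finset.range t, zD t 0 n x := by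
  classical
  rw [← Fin.sum_univ_eq_sum_range (fun x => zD t 0 n x)]
  simp only [← zD_count]
  rw [zW, Nat.card_eq_fintype_card, Fintype.card_subtype, Finset.card_filter]
  push_cast
  rw [← Equiv.sum_comp (Fin.consEquiv (fun _ : Fin (n + 1) => Fin t)), Fintype.sum_prod_type]
  refine Finset.sum_congr rfl fun y _ => Finset.sum_congr rfl fun f _ => ?_
  exact if_congr (zigB_zero _ _ _) rfl rfl

theorem zD_add_two (t n : ℕ) : ∀ b x : ℕ, zD t (b + 2) n x = zD t b n x := by
  induction n with
  | zero => intro b x; rfl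
  | succ n ih =>
    intro b x
    simp only [zD]
    refine Finset.sum_congr rfl fun y _ => ?_
    rw [show b + 2 + 1 = b + 1 + 2 by ring, ih]
    refine if_congr ?_ rfl rfl
    unfold zrel
    simp [Nat.odd_add, parity_simps]

theorem zS (t x : ℕ) (hx : x < t) (g : ℕ → ℚ) :
    (∑ y ∈ Finset.range t, if y ≤ x then g y else 0) = ∑ y ∈ Finset.range (x + 1), g y := by
  rw [← Finset.sum_filter]
  refine Finset.sum_congr ?_ fun _ _ => rfl
  ext y; simp; omega

theorem zU (t y : ℕ) (hy : y < t) (g : ℕ → ℚ) :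
    (∑ z ∈ Finset.range t, if y ≤ z then g z else 0) =
      ∑ z ∈ Finset.range t, g z - ∑ z ∈ Finset.range y, g z := by
  rw [eq_sub_iff_add_eq, ← Finset.sum_filter, add_comm,
    ← Finset.sum_filter_add_sum_filter_not (Finset.range t) (fun z => z < y) g]
  congr 1
  · refine Finset.sum_congr ?_ fun _ _ => rfl
    ext z; simp; omega
  · refine Finset.sum_congr ?_ fun _ _ => rfl
    ext z; simp

theorem zD_one (t x : ℕ) (hx : x < t) : zD t 0 1 x = x + 1 := by
  simp only [zD, zrel, Nat.not_odd_zero, if_false]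
  rw [zS t x hx]
  simp

theorem zD_rec (t n x : ℕ) (hx : x < t) : zD t 0 (n + 2) x =
    zW t (n + 1) * (x + 1) -
      ∑ y ∈ Finset.range (x + 1), ∑ z ∈ Finset.range y, zD t 0 n z := by
  have h1 : zD t 0 (n + 2) x = ∑ y ∈ Finset.range t, if y ≤ x then
      (∑ z ∈ Finset.range t, if y ≤ z then zD t 0 n z else 0) else 0 := by
    simp [zD, zrel, zD_add_two t n 0]
  rw [h1, zS t x hx, zW_succ]
  rw [Finset.sum_congr rfl (fun y hy => zU t y (by have := Finset.mem_range.1 hy; omega) _)]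
  rw [Finset.sum_sub_distrib]
  simp
  ring

theorem zchoose (a b y : ℕ) (h : a ≤ b) :
    ∑ z ∈ Finset.range y, ((z + a).choose b : ℚ) = ((y + a).choose (b + 1) : ℚ) := by
  induction y with
  | zero => simp [Nat.choose_eq_zero_of_lt (show a < b + 1 by omega)]
  | succ y ih =>
    rw [Finset.sum_range_succ, ih, show y + 1 + a = (y + a) + 1 by ring, Nat.choose_succ_succ]
    push_cast; ring

theorem zchoose2 (a b x : ℕ) (h : a ≤ b) :
    ∑ y ∈ Finset.range (x + 1), ∑ z ∈ Finset.range y, ((z + a).choose b : ℚ)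
      = ((x + (a + 1)).choose (b + 2) : ℚ) := by
  simp only [zchoose a b _ h]
  rw [zchoose a (b + 1) _ (by omega)]
  congr 2
  ring

/-- general solution of the recursion -/
theorem zsolve (t c r : ℕ) (hc : c ≤ r) (w : ℕ → ℚ) (e : ℕ → ℕ → ℚ) (s : ℚ)
    (h0 : ∀ x < t, e 0 x = s * ((x + c).choose r : ℚ))
    (hs : ∀ k, ∀ x < t, e (k + 1) x = w k * (x + 1) -
      ∑ y ∈ Finset.range (x + 1), ∑ z ∈ Finset.range y, e k z) (k : ℕ) :
    ∀ x < t, e k x = (-1) ^ k * s * ((x + (c + k)).choose (r + 2 * k) : ℚ) +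
      ∑ i ∈ Finset.range k, (-1) ^ i * w (k - 1 - i) * ((x + (i + 1)).choose (2 * i + 1) : ℚ) := by
  induction k with
  | zero => intro x hx; simp [h0 x hx]
  | succ k ih =>
    intro x hx
    rw [hs k x hx]
    have : ∑ y ∈ Finset.range (x + 1), ∑ z ∈ Finset.range y, e k z =
        ∑ y ∈ Finset.range (x + 1), ∑ z ∈ Finset.range y,
          ((-1) ^ k * s * ((z + (c + k)).choose (r + 2 * k) : ℚ) +
      ∑ i ∈ Finset.range k, (-1) ^ i * w (k - 1 - i) * ((z + (i + 1)).choose (2 * i + 1) : ℚ)) := by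
      refine Finset.sum_congr rfl fun y hy => Finset.sum_congr rfl fun z hz => ih z ?_
      have := Finset.mem_range.1 hy
      have := Finset.mem_range.1 hz
      omega
    rw [this]
    simp only [Finset.sum_add_distrib, ← Finset.mul_sum]
    rw [zchoose2 _ _ _ (by omega)]
    have h2 : ∑ y ∈ Finset.range (x + 1), ∑ z ∈ Finset.range y, ∑ i ∈ Finset.range k,
        (-1) ^ i * w (k - 1 - i) * ((z + (i + 1)).choose (2 * i + 1) : ℚ) =
        ∑ i ∈ Finset.range k, (-1) ^ i * w (k - 1 - i) *
          ((x + (i + 1 + 1)).choose (2 * i + 1 + 2) : ℚ) := by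
      simp only [Finset.sum_comm (t := Finset.range k)]
      refine Finset.sum_congr rfl fun i _ => ?_
      simp only [← Finset.mul_sum]
      rw [zchoose2 _ _ _ (by omega)]
    rw [h2, Finset.sum_range_succ']
    have h3 : ∀ i ∈ Finset.range k, (-1) ^ (i + 1) * w (k + 1 - 1 - (i + 1)) *
        ((x + (i + 1 + 1)).choose (2 * (i + 1) + 1) : ℚ) =
        - ((-1) ^ i * w (k - 1 - i) * ((x + (i + 1 + 1)).choose (2 * i + 1 + 2) : ℚ)) := by
      intro i _
      rw [show k + 1 - 1 - (i + 1) = k - 1 - i by omega, show 2 * (i + 1) + 1 = 2 * i + 1 + 2 by ring]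
      ring
    rw [Finset.sum_congr rfl h3, Finset.sum_neg_distrib]
    rw [show r + 2 * (k + 1) = r + 2 * k + 2 by ring, show c + (k + 1) = c + k + 1 by ring]
    simp
    ring

theorem zsum (t c r k : ℕ) (hc : c ≤ r) (s : ℚ) (w : ℕ → ℚ) (e : ℕ → ℚ)
    (h : ∀ x < t, e x = (-1) ^ k * s * ((x + (c + k)).choose (r + 2 * k) : ℚ) +
      ∑ i ∈ Finset.range k, (-1) ^ i * w (k - 1 - i) * ((x + (i + 1)).choose (2 * i + 1) : ℚ)) :
    ∑ x ∈ Finset.range t, e x = (-1) ^ k * s * ((t + (c + k)).choose (r + 2 * k + 1) : ℚ) +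
      ∑ i ∈ Finset.range k, (-1) ^ i * w (k - 1 - i) * ((t + (i + 1)).choose (2 * i + 2) : ℚ) := by
  rw [Finset.sum_congr rfl (fun x hx => h x (Finset.mem_range.1 hx)), Finset.sum_add_distrib,
    Finset.sum_comm]
  simp only [← Finset.mul_sum]
  rw [zchoose _ _ _ (by omega)]
  congr 1
  refine Finset.sum_congr rfl fun i _ => ?_
  rw [zchoose _ _ _ (by omega)]

theorem zW_odd (t k : ℕ) : zW t (2 * k + 1) = (-1) ^ k * ((t + k).choose (2 * k + 1) : ℚ) +
    ∑ i ∈ Finset.range k, (-1) ^ i * zW t (2 * (k - 1 - i) + 1) *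
      ((t + (i + 1)).choose (2 * i + 2) : ℚ) := by
  have := zsum t 0 0 k le_rfl 1 (fun k => zW t (2 * k + 1)) (zD t 0 (2 * k))
    (zsolve t 0 0 le_rfl (fun k => zW t (2 * k + 1)) (fun k => zD t 0 (2 * k)) 1
      (by intro x _; simp [zD]) (fun k x hx => zD_rec t (2 * k) x hx) k)
  rw [zW_succ, this]
  simp

theorem zW_even (t k : ℕ) : zW t (2 * (k + 1)) =
    ∑ i ∈ Finset.range (k + 1), (-1) ^ i * zW t (2 * (k - i)) *
      ((t + (i + 1)).choose (2 * i + 2) : ℚ) := by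
  have := zsum t 1 1 k le_rfl 1 (fun k => zW t (2 * (k + 1))) (zD t 0 (2 * k + 1))
    (zsolve t 1 1 le_rfl (fun k => zW t (2 * (k + 1))) (fun k => zD t 0 (2 * k + 1)) 1
      (by intro x hx; simp [zD_one t x hx]) (fun k x hx => zD_rec t (2 * k + 1) x hx) k)
  rw [show 2 * (k + 1) = (2 * k + 1) + 1 by ring, zW_succ, this, Finset.sum_range_succ, add_comm]
  congr 1
  · refine Finset.sum_congr rfl fun i hi => ?_
    have := Finset.mem_range.1 hi
    rw [show k - 1 - i + 1 = k - i by omega]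
  · rw [Nat.sub_self, zW_zero, show 1 + 2 * k + 1 = 2 * k + 2 by ring, add_comm 1 k]

theorem binomPoly_eval (i m t : ℕ) : (binomPoly i m).eval (t : ℚ) = ((t + i).choose m : ℚ) := by
  have h : ∏ j ∈ Finset.range m, ((t : ℚ) + ((i : ℚ) - (j : ℚ))) = ((t + i).descFactorial m : ℚ) := by
    rw [← descPochhammer_eval_eq_descFactorial ℚ, descPochhammer_eval_eq_prod_range]
    refine Finset.prod_congr rfl fun j _ => ?_
    push_cast; ring
  unfold binomPoly
  rw [eval_mul, eval_prod]
  simp only [eval_C, eval_add, eval_X]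
  rw [h, Nat.descFactorial_eq_factorial_mul_choose]
  have : (m.factorial : ℚ) ≠ 0 := by exact_mod_cast m.factorial_ne_zero
  push_cast
  field_simp

theorem poly_eq_of_pos (p q : Polynomial ℚ) (h : ∀ t : ℕ, 0 < t → p.eval (t : ℚ) = q.eval (t : ℚ)) :
    p = q := by
  apply Polynomial.eq_of_infinite_eval_eq
  refine Set.Infinite.mono ?_ (Set.infinite_range_of_injective
    (f := fun n : ℕ => ((n + 1 : ℕ) : ℚ)) ?_)
  · rintro _ ⟨n, rfl⟩
    exact h (n + 1) (by omega)
  · intro a b hab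
    simpa using hab

theorem sum_Icc_shift (k : ℕ) (g : ℕ → ℚ) :
    ∑ i ∈ Finset.Icc 1 k, g i = ∑ i ∈ Finset.range k, g (i + 1) := by
  rw [Finset.range_eq_Ico, Finset.sum_Ico_add' g 0 k 1]
  rfl

/-- minor-expansion recursions for the order polynomials of zigzag
posets: for `k ≥ 1`,
`Ω(Z_{2k+1};t) = (−1)^k binom(t+k,2k+1) + Σ_{i=1}^k (−1)^{i+1} binom(t+i,2i) Ω(Z_{2(k−i)+1};t)`
and `Ω(Z_{2k};t) = Σ_{i=1}^k (−1)^{i+1} binom(t+i,2i) Ω(Z_{2(k−i)};t)`.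
Here `Ω n` is the order polynomial of `Z_n`, characterized by its values at
positive integers (in particular `Ω 0 = 1` and `Ω 1 = t`). -/
theorem zigzag_order_poly_recursion (Ω : ℕ → Polynomial ℚ)
    (hΩ : ∀ n t : ℕ, 0 < t →
      (Ω n).eval (t : ℚ) = (Nat.card {f : Fin n → Fin t // ZigzagMono n t f} : ℚ))
    (k : ℕ) (hk : 1 ≤ k) :
    Ω (2 * k + 1) = ((-1 : ℚ) ^ k) • binomPoly k (2 * k + 1) +
        ∑ i ∈ Finset.Icc 1 k,
          ((-1 : ℚ) ^ (i + 1)) • (binomPoly i (2 * i) * Ω (2 * (k - i) + 1)) ∧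
    Ω (2 * k) =
        ∑ i ∈ Finset.Icc 1 k,
          ((-1 : ℚ) ^ (i + 1)) • (binomPoly i (2 * i) * Ω (2 * (k - i))) := by
  have hW : ∀ n t : ℕ, 0 < t → (Ω n).eval (t : ℚ) = zW t n := hΩ
  constructor
  · apply poly_eq_of_pos
    intro t ht
    simp only [eval_add, eval_smul, eval_finsetSum, eval_mul, binomPoly_eval, hW _ t ht,
      smul_eq_mul]
    rw [sum_Icc_shift, zW_odd]
    congr 1
    refine Finset.sum_congr rfl fun i _ => ?_
    rw [show k - 1 - i = k - (i + 1) by omega, show 2 * i + 2 = 2 * (i + 1) by ring]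
    ring
  · apply poly_eq_of_pos
    intro t ht
    simp only [eval_smul, eval_finsetSum, eval_mul, binomPoly_eval, hW _ t ht, smul_eq_mul]
    obtain ⟨k, rfl⟩ : ∃ m, k = m + 1 := ⟨k - 1, by omega⟩
    rw [sum_Icc_shift, zW_even]
    refine Finset.sum_congr rfl fun i _ => ?_
    rw [show k + 1 - (i + 1) = k - i by omega, show 2 * i + 2 = 2 * (i + 1) by ring]
    ring
end

section
/- For every integer n ≥ 1, the polynomial Ω(Z_{2n+1}; t − 1/2) in the variable t has constant coefficient 0, and its coefficient of t^1 equals w_−(2n+1) = −(n!)^2 / (2n · (2n+1)!). -/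
open Polynomial

/-- transfer recursion -/
def zc (t : ℕ) : ℕ → ℕ → ℕ
  | 0, _ => 1
  | m + 1, v => if Odd m then ∑ u ∈ Finset.range (v + 1), zc t m u
      else ∑ u ∈ Finset.Ico v t, zc t m u

lemma zmono_snoc (m t : ℕ) (g : Fin (m + 1) → Fin t) (v : Fin t) :
    ZigzagMono (m + 2) t (Fin.snoc g v : Fin (m + 2) → Fin t) ↔
      ZigzagMono (m + 1) t g ∧ (if Odd m then g (Fin.last m) ≤ v else v ≤ g (Fin.last m)) := by
  have e1 : ∀ j (h : j < m + 1) (h' : j < m + 2),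
      (Fin.snoc g v : Fin (m + 2) → Fin t) ⟨j, h'⟩ = g ⟨j, h⟩ := by
    intro j h h'
    exact Fin.snoc_castSucc (α := fun _ => Fin t) v g ⟨j, h⟩
  have e2 : ∀ (h' : m + 1 < m + 2),
      (Fin.snoc g v : Fin (m + 2) → Fin t) ⟨m + 1, h'⟩ = v := by
    intro h'
    exact Fin.snoc_last (α := fun _ => Fin t) v g
  constructor
  · intro H
    constructor
    · intro j h
      have := H j (by omega)
      rw [e1 j (by omega), e1 (j + 1) h] at this
      exact this
    · have := H m (by omega)
      rw [e1 m (by omega), e2] at this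
      exact this
  · rintro ⟨H1, H2⟩ j h
    rcases Nat.lt_or_ge (j + 1) (m + 1) with hj | hj
    · have := H1 j hj
      rw [e1 j (by omega), e1 (j + 1) hj]
      exact this
    · obtain rfl : j = m := by omega
      rw [e1 j (by omega), e2]
      exact H2

open Classical in
lemma zc_card (t m : ℕ) (v : Fin t) :
    (Finset.univ.filter (fun f : Fin (m + 1) → Fin t =>
      ZigzagMono (m + 1) t f ∧ f (Fin.last m) = v)).card = zc t m v := by
  induction m generalizing v with
  | zero =>
    rw [zc, Finset.card_eq_one]
    refine ⟨fun _ => v, ?_⟩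
    ext f
    simp only [Finset.mem_filter, Finset.mem_univ, true_and, Finset.mem_singleton]
    constructor
    · rintro ⟨_, h⟩
      funext i
      rw [← h]
      congr 1
      exact Fin.ext (by have := i.2; simp)
    · rintro rfl
      exact ⟨fun j h => by omega, rfl⟩
  | succ m ih =>
    have key : (Finset.univ.filter (fun f : Fin (m + 2) → Fin t =>
        ZigzagMono (m + 2) t f ∧ f (Fin.last (m + 1)) = v)).card =
        (Finset.univ.filter (fun g : Fin (m + 1) → Fin t =>
          ZigzagMono (m + 1) t g ∧
            (if Odd m then g (Fin.last m) ≤ v else v ≤ g (Fin.last m)))).card := by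
      symm
      apply Finset.card_bij (fun g _ => (Fin.snoc g v : Fin (m + 2) → Fin t))
      · intro g hg
        simp only [Finset.mem_filter, Finset.mem_univ, true_and] at hg ⊢
        refine ⟨(zmono_snoc m t g v).2 hg, ?_⟩
        exact Fin.snoc_last (α := fun _ => Fin t) v g
      · intro g _ g' _ h
        funext i
        have := congrFun h i.castSucc
        simpa using this
      · intro f hf
        simp only [Finset.mem_filter, Finset.mem_univ, true_and] at hf
        have hs : (Fin.snoc (fun i : Fin (m + 1) => f i.castSucc) v : Fin (m + 2) → Fin t) = f := by
          rw [← hf.2]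
          exact Fin.snoc_init_self (α := fun _ => Fin t) f
        refine ⟨fun i => f i.castSucc, ?_, hs⟩
        simp only [Finset.mem_filter, Finset.mem_univ, true_and]
        rw [← zmono_snoc, hs]
        exact hf.1
    rw [key]
    rw [Finset.card_eq_sum_card_fiberwise (f := fun g : Fin (m + 1) → Fin t => g (Fin.last m))
      (t := Finset.univ.filter (fun u : Fin t => if Odd m then u ≤ v else v ≤ u))
      (by intro g hg; simp at hg ⊢; exact hg.2)]
    have h2 : ∀ u ∈ Finset.univ.filter (fun u : Fin t => if Odd m then u ≤ v else v ≤ u),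
        ((Finset.univ.filter (fun g : Fin (m + 1) → Fin t =>
          ZigzagMono (m + 1) t g ∧
            (if Odd m then g (Fin.last m) ≤ v else v ≤ g (Fin.last m)))).filter
            (fun g => g (Fin.last m) = u)).card = zc t m u := by
      intro u hu
      rw [← ih u]
      congr 1
      ext g
      simp only [Finset.mem_filter, Finset.mem_univ, true_and] at hu ⊢
      constructor
      · rintro ⟨⟨a, b⟩, c⟩
        exact ⟨a, c⟩
      · rintro ⟨a, c⟩
        exact ⟨⟨a, by rw [c]; exact hu⟩, c⟩
    rw [Finset.sum_congr rfl h2, zc]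
    by_cases hm : Odd m
    · simp only [hm, if_true]
      apply Finset.sum_bij (fun (u : Fin t) _ => (u : ℕ))
      · intro a ha
        simp at ha ⊢
        have := Fin.le_def.1 ha
        omega
      · intro a _ b _ h
        exact Fin.ext h
      · intro b hb
        have hb' := Finset.mem_range.1 hb
        refine ⟨⟨b, by have := v.2; omega⟩, ?_, rfl⟩
        simp only [Finset.mem_filter, Finset.mem_univ, true_and]
        exact Fin.le_def.2 (by show _ ≤ _; dsimp only; omega)
      · intros; rfl
    · simp only [hm, if_false]
      apply Finset.sum_bij (fun (u : Fin t) _ => (u : ℕ))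
      · intro a ha
        simp at ha ⊢
        exact ha
      · intro a _ b _ h
        exact Fin.ext h
      · intro b hb
        have hb' := Finset.mem_Ico.1 hb
        refine ⟨⟨b, hb'.2⟩, ?_, rfl⟩
        simp only [Finset.mem_filter, Finset.mem_univ, true_and]
        exact Fin.le_def.2 (by show _ ≤ _; dsimp only; omega)
      · intros; rfl

lemma zc_total (t n : ℕ) :
    Nat.card {f : Fin (2 * n + 1) → Fin t // ZigzagMono (2 * n + 1) t f} = zc t (2 * n + 1) 0 := by
  classical
  rw [Nat.card_eq_fintype_card, Fintype.card_subtype, zc]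
  rw [if_neg (by simp)]
  rw [Finset.card_eq_sum_card_fiberwise
    (f := fun g : Fin (2 * n + 1) → Fin t => g (Fin.last (2 * n))) (t := Finset.univ)
    (by intro g hg; simp)]
  rw [Nat.Ico_zero_eq_range, Finset.sum_range]
  apply Finset.sum_congr rfl
  intro u _
  rw [← zc_card, Finset.filter_filter]

noncomputable section

def zQ (t v : ℕ) : PowerSeries ℚ := PowerSeries.mk fun n => (zc t (2 * n) v : ℚ)
def zR (t v : ℕ) : PowerSeries ℚ := PowerSeries.mk fun n => (zc t (2 * n + 1) v : ℚ)

lemma zR_eq (t v : ℕ) : zR t v = ∑ u ∈ Finset.Ico v t, zQ t u := by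
  ext n
  simp [zR, zQ, zc]

lemma zR_top (t : ℕ) : zR t t = 0 := by simp [zR_eq]

lemma zR_succ (t v : ℕ) (h : v < t) : zR t v = zQ t v + zR t (v + 1) := by
  rw [zR_eq, zR_eq, Finset.sum_eq_sum_Ico_succ_bot h]

lemma zQ_eq (t v : ℕ) : zQ t v = 1 + PowerSeries.X * ∑ u ∈ Finset.range (v + 1), zR t u := by
  ext n
  cases n with
  | zero => simp [zQ, zc]
  | succ n =>
    rw [map_add, PowerSeries.coeff_succ_X_mul, map_sum]
    have : 2 * (n + 1) = (2 * n + 1) + 1 := by ring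
    simp only [zQ, zR, PowerSeries.coeff_mk, this]
    rw [zc]
    simp [PowerSeries.coeff_one]

def zstep (p : PowerSeries ℚ × PowerSeries ℚ) : PowerSeries ℚ × PowerSeries ℚ :=
  (p.1 + PowerSeries.X * p.2, p.2 - (p.1 + PowerSeries.X * p.2))

lemma zstep_iter (t v : ℕ) (h : v < t) :
    zstep^[v + 1] (1, zR t 0) = (zQ t v, zR t (v + 1)) := by
  induction v with
  | zero =>
    have h1 : zQ t 0 = 1 + PowerSeries.X * zR t 0 := by simp [zQ_eq]
    have h2 := zR_succ t 0 h
    simp only [zero_add, Function.iterate_one, zstep]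
    rw [← h1, h2]
    simp
  | succ v ih =>
    rw [Function.iterate_succ_apply', ih (by omega), zstep]
    have h1 : zQ t (v + 1) = zQ t v + PowerSeries.X * zR t (v + 1) := by
      rw [zQ_eq, zQ_eq t v, Finset.sum_range_succ _ (v + 1)]; ring
    have h2 := zR_succ t (v + 1) h
    simp only
    rw [← h1, h2]
    simp

lemma zstep_zero (t : ℕ) : (zstep^[t] (1, zR t 0)).2 = 0 := by
  cases t with
  | zero => simp [zR_top]
  | succ t => rw [zstep_iter _ _ (Nat.lt_succ_self t)]; exact zR_top _

lemma zstep_lin (t : ℕ) : ∃ A B : PowerSeries ℚ, PowerSeries.constantCoeff B = 1 ∧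
    ∀ a b, (zstep^[t] (a, b)).2 = A * a + B * b := by
  induction t with
  | zero => exact ⟨0, 1, by simp, by simp⟩
  | succ t ih =>
    obtain ⟨A, B, hB, h⟩ := ih
    refine ⟨A - B, A * PowerSeries.X + B * (1 - PowerSeries.X), by simp [hB], ?_⟩
    intro a b
    rw [Function.iterate_succ_apply, zstep, h]
    ring

lemma zrec (t : ℕ) : zR (t + 1) 0 * (1 - PowerSeries.X - PowerSeries.X * zR t 0) = zR t 0 + 1 := by
  obtain ⟨A, B, hB, h⟩ := zstep_lin t
  have h0 := zstep_zero t
  have h1 := zstep_zero (t + 1)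
  rw [Function.iterate_succ_apply, zstep] at h1
  rw [h] at h0 h1
  have hB0 : B ≠ 0 := by rintro rfl; simp at hB
  apply mul_left_cancel₀ hB0
  linear_combination h1 - (1 + PowerSeries.X * zR (t + 1) 0) * h0

lemma zode (t : ℕ) :
    (4 - PowerSeries.X) * (2 * PowerSeries.X * PowerSeries.derivative (R := ℚ) (zR t 0)) * 2 =
      - 4 * (2 * zR t 0 + 1) + (2 * t + 1 : PowerSeries ℚ) * ((4 - PowerSeries.X) + PowerSeries.X * (2 * zR t 0 + 1) ^ 2) := by
  induction t with
  | zero => simp [zR_top]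
  | succ t ih =>
    have hr := zrec t
    have hd := congrArg (PowerSeries.derivative (R := ℚ)) hr
    simp only [Derivation.leibniz, map_sub, map_add, smul_eq_mul, PowerSeries.derivative_X,
      PowerSeries.derivative_one] at hd
    set u := zR t 0
    set w := zR (t + 1) 0
    set u' := PowerSeries.derivative (R := ℚ) u
    set w' := PowerSeries.derivative (R := ℚ) w
    have hD0 : (1 - PowerSeries.X - PowerSeries.X * u : PowerSeries ℚ) ≠ 0 := by
      intro h
      have := congrArg PowerSeries.constantCoeff h
      simp at this
    have h2 : (1 - PowerSeries.X - PowerSeries.X * u) ^ 2 * w' = u' + (1 + u) ^ 2 := by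
      linear_combination (1 - PowerSeries.X - PowerSeries.X * u) * hd + (1 + u + PowerSeries.X * u') * hr
    apply mul_left_cancel₀ (pow_ne_zero 2 hD0)
    push_cast
    generalize hD : (1 - PowerSeries.X - PowerSeries.X * u : PowerSeries ℚ) = D at *
    have e : D ^ 2 * w ^ 2 = (u + 1) ^ 2 := by rw [← hr]; ring
    have e1 : D ^ 2 * w = (u + 1) * D := by rw [← hr]; ring
    subst hD
    linear_combination (4 - PowerSeries.X) * (4 * PowerSeries.X) * h2 + ih + 8 * e1
      - (2 * t + 3) * (4 * PowerSeries.X * e + 4 * PowerSeries.X * e1)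
end


noncomputable def zP (Ω : ℕ → Polynomial ℚ) (n : ℕ) : ℚ[X] :=
  (Ω (2 * n + 1)).comp (X - C (1 / 2)) + if n = 0 then C (1 / 2) else 0

lemma zpoly_ext (p q : ℚ[X]) (h : ∀ t : ℕ, 0 < t → p.eval ((t : ℚ) + 1 / 2) = q.eval ((t : ℚ) + 1 / 2)) :
    p = q := by
  apply Polynomial.eq_of_infinite_eval_eq
  apply Set.infinite_of_injective_forall_mem (f := fun t : ℕ => ((t + 1 : ℕ) : ℚ) + 1 / 2)
  · intro a b hab
    simpa using hab
  · intro t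
    exact h (t + 1) (Nat.succ_pos t)

lemma zcoeff (t n : ℕ) :
    (2 * n + 3 : ℚ) * (PowerSeries.coeff (n + 1) (zR t 0) + if n + 1 = 0 then 1 / 2 else 0) =
      n / 2 * (PowerSeries.coeff n (zR t 0) + if n = 0 then 1 / 2 else 0) +
      (t + 1 / 2) * (∑ p ∈ Finset.HasAntidiagonal.antidiagonal n,
        (PowerSeries.coeff p.1 (zR t 0) + if p.1 = 0 then 1 / 2 else 0) *
        (PowerSeries.coeff p.2 (zR t 0) + if p.2 = 0 then 1 / 2 else 0) -
        if n = 0 then 1 / 4 else 0) := by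
  have hV : ∀ k, PowerSeries.coeff k (zR t 0 + PowerSeries.C (1 / 2 : ℚ)) =
      PowerSeries.coeff k (zR t 0) + if k = 0 then 1 / 2 else 0 := by
    intro k
    rw [map_add, PowerSeries.coeff_C]
  have hsum : (∑ p ∈ Finset.HasAntidiagonal.antidiagonal n,
        (PowerSeries.coeff p.1 (zR t 0) + if p.1 = 0 then 1 / 2 else 0) *
        (PowerSeries.coeff p.2 (zR t 0) + if p.2 = 0 then 1 / 2 else 0)) =
      PowerSeries.coeff n ((zR t 0 + PowerSeries.C (1 / 2 : ℚ)) ^ 2) := by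
    rw [pow_two, PowerSeries.coeff_mul]
    simp only [hV]
  rw [hsum]
  have hode := zode t
  have hC : (2 : PowerSeries ℚ) * PowerSeries.C (1 / 2 : ℚ) = 1 := by
    rw [← map_ofNat (PowerSeries.C (R := ℚ)) 2, ← map_mul]; norm_num
  have hode2 : PowerSeries.C (16 : ℚ) * (PowerSeries.X * PowerSeries.derivative (R := ℚ) (zR t 0)) -
      PowerSeries.C (4 : ℚ) *
        (PowerSeries.X * (PowerSeries.X * PowerSeries.derivative (R := ℚ) (zR t 0))) =
      PowerSeries.C (-8 : ℚ) * zR t 0 + PowerSeries.C (-4 : ℚ) +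
      PowerSeries.C (2 * t + 1 : ℚ) * (PowerSeries.C (4 : ℚ) + PowerSeries.X *
        (PowerSeries.C (4 : ℚ) * (zR t 0 + PowerSeries.C (1 / 2 : ℚ)) ^ 2 - 1)) := by
    have e : PowerSeries.C (2 * t + 1 : ℚ) = (2 * t + 1 : PowerSeries ℚ) := by
      rw [map_add, map_mul, map_ofNat, map_natCast, map_one]
    have e4 : PowerSeries.C (4 : ℚ) = (4 : PowerSeries ℚ) := map_ofNat _ _
    have e16 : PowerSeries.C (16 : ℚ) = (16 : PowerSeries ℚ) := map_ofNat _ _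
    have e8 : PowerSeries.C (-8 : ℚ) = (-8 : PowerSeries ℚ) := by
      rw [map_neg, map_ofNat]
    have e4' : PowerSeries.C (-4 : ℚ) = (-4 : PowerSeries ℚ) := by
      rw [map_neg, map_ofNat]
    have e5 : 4 * (zR t 0 + PowerSeries.C (1 / 2 : ℚ)) ^ 2 = (2 * zR t 0 + 1) ^ 2 := by
      rw [← hC]; ring
    rw [e, e4, e16, e8, e4', e5]
    linear_combination hode
  generalize hK : (2 * t + 1 : ℚ) = K at hode2
  have h := congrArg (PowerSeries.coeff (n + 1)) hode2
  simp only [map_add, map_sub, PowerSeries.coeff_C_mul, PowerSeries.coeff_succ_X_mul,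
    PowerSeries.coeff_C, PowerSeries.coeff_derivative, PowerSeries.coeff_one] at h
  have hx : PowerSeries.coeff n (PowerSeries.X * PowerSeries.derivative (R := ℚ) (zR t 0)) =
      n * PowerSeries.coeff n (zR t 0) := by
    cases n with
    | zero => simp
    | succ n =>
      rw [PowerSeries.coeff_succ_X_mul, PowerSeries.coeff_derivative]; push_cast; ring
  rw [hx] at h
  subst hK
  rw [if_neg (by omega)] at h ⊢
  by_cases hn : n = 0
  · subst hn
    simp only [if_true] at h ⊢
    push_cast at h ⊢
    linear_combination h / 8
  · simp only [hn, Nat.succ_ne_zero, if_false] at h ⊢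
    linear_combination h / 8

/-- for `n ≥ 1`, the polynomial `Ω(Z_{2n+1}; t − 1/2)` has
constant coefficient `0` and linear coefficient `w_−(2n+1) = −(n!)²/(2n·(2n+1)!)`. -/
theorem zigzag_odd_shifted_constant_and_linear_coeff (Ω : ℕ → Polynomial ℚ)
    (hΩ : ∀ m t : ℕ, 0 < t →
      (Ω m).eval (t : ℚ) = (Nat.card {f : Fin m → Fin t // ZigzagMono m t f} : ℚ))
    (n : ℕ) (hn : 1 ≤ n) :
    ((Ω (2 * n + 1)).comp (X - C (1 / 2))).coeff 0 = 0 ∧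
    ((Ω (2 * n + 1)).comp (X - C (1 / 2))).coeff 1 =
      -((n.factorial : ℚ)) ^ 2 / (2 * n * ((2 * n + 1).factorial : ℚ)) := by
  have h12 : ∀ n t : ℕ, 0 < t → ((zP Ω n).eval ((t : ℚ) + 1 / 2)) =
      PowerSeries.coeff n (zR t 0) + if n = 0 then 1 / 2 else 0 := by
    intro n t ht
    have := hΩ (2 * n + 1) t ht
    rw [zc_total] at this
    simp only [zP, eval_add, eval_comp, eval_sub, eval_X, eval_C, add_sub_cancel_right, this, zR,
      PowerSeries.coeff_mk]
    split_ifs <;> simp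
  have hp0 : zP Ω 0 = X := by
    apply zpoly_ext
    intro t ht
    rw [h12 0 t ht]
    simp [zR, zc]
  have hrec : ∀ n : ℕ, C (2 * n + 3 : ℚ) * zP Ω (n + 1) = C (n / 2 : ℚ) * zP Ω n +
      X * (∑ p ∈ Finset.HasAntidiagonal.antidiagonal n, zP Ω p.1 * zP Ω p.2 - if n = 0 then C (1 / 4) else 0) := by
    intro n
    apply zpoly_ext
    intro t ht
    have h := zcoeff t n
    have hs : eval ((t : ℚ) + 1 / 2) (if n = 0 then C (1 / 4) else 0 : ℚ[X]) =
        if n = 0 then 1 / 4 else 0 := by split_ifs <;> simp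
    simp only [eval_add, eval_mul, eval_C, eval_X, eval_sub, eval_finsetSum, h12 _ t ht, hs]
    simpa using h
  have hc0 : ∀ n, (zP Ω n).coeff 0 = 0 := by
    intro n
    induction n with
    | zero => simp [hp0]
    | succ n ih =>
      have h := congrArg (fun p => coeff p 0) (hrec n)
      simp only [coeff_C_mul, coeff_add, coeff_X_mul_zero, ih] at h
      have : (2 * n + 3 : ℚ) ≠ 0 := by positivity
      simpa [this] using h
  have hc1 : ∀ n : ℕ, (2 * n + 3 : ℚ) * (zP Ω (n + 1)).coeff 1 =
      n / 2 * (zP Ω n).coeff 1 - if n = 0 then 1 / 4 else 0 := by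
    intro n
    have h := congrArg (fun p => coeff p 1) (hrec n)
    have hs : (if n = 0 then C (1 / 4) else 0 : ℚ[X]).coeff 0 =
        if n = 0 then 1 / 4 else 0 := by split_ifs <;> simp
    simp only [coeff_C_mul, coeff_add, coeff_X_mul, coeff_sub, finsetSum_coeff,
      mul_coeff_zero, hc0, hs] at h
    rw [h]; simp; ring
  have hmain : ∀ n : ℕ, (zP Ω (n + 1)).coeff 1 =
      -(((n + 1).factorial : ℚ)) ^ 2 / (2 * (n + 1 : ℕ) * ((2 * (n + 1) + 1).factorial : ℚ)) := by
    intro n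
    induction n with
    | zero =>
      have := hc1 0
      norm_num [Nat.factorial] at this ⊢
      linarith
    | succ n ih =>
      have h := hc1 (n + 1)
      rw [ih] at h
      have hf : (2 * (n + 1 + 1) + 1).factorial =
          (2 * n + 5) * ((2 * n + 4) * (2 * (n + 1) + 1).factorial) := by
        rw [show 2 * (n + 1 + 1) + 1 = (2 * (n + 1) + 1) + 1 + 1 by ring, Nat.factorial_succ,
          Nat.factorial_succ (2 * (n + 1) + 1)]
        ring
      rw [hf, Nat.factorial_succ (n + 1)]
      have hF : ((2 * (n + 1) + 1).factorial : ℚ) ≠ 0 := by positivity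
      have h5 : (2 * ((n + 1 : ℕ) : ℚ) + 3) ≠ 0 := by positivity
      apply mul_left_cancel₀ h5
      rw [h]
      generalize ((2 * (n + 1) + 1).factorial) = F at *
      generalize (n + 1).factorial = G at *
      push_cast
      have h6 : ((n : ℚ) + 1) ≠ 0 := by positivity
      have h7 : ((n : ℚ) + 1 + 1) ≠ 0 := by positivity
      have h8 : (2 * (n : ℚ) + 5) ≠ 0 := by positivity
      have h9 : (2 * (n : ℚ) + 4) ≠ 0 := by positivity
      field_simp
      ring
  obtain ⟨k, rfl⟩ : ∃ k, n = k + 1 := ⟨n - 1, by omega⟩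
  have hz : zP Ω (k + 1) = (Ω (2 * (k + 1) + 1)).comp (X - C (1 / 2)) := by simp [zP]
  rw [← hz]
  exact ⟨hc0 _, hmain k⟩
end

section
/- For every integer n ≥ 1, the polynomial Ω(Z_{2n}; t − 1/2) in the variable t has coefficient of t^1 equal to 0, and its constant coefficient equals R_{2n} = −(1/16^n) · (2/n) · binom(2n−2, n−1). -/
open Polynomial

namespace ZZ

/-- zigzag counts with prescribed last value. -/
def a (t : ℕ) : ℕ → ℕ → ℕ
  | 0, _ => 1
  | m + 1, i => if Odd m then ∑ j ∈ Finset.range (i + 1), a t m j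
      else ∑ j ∈ Finset.Ico i t, a t m j

/-- step relation. -/
def rel (m x y : ℕ) : Prop := if Odd m then x ≤ y else y ≤ x

theorem zig_snoc (m t : ℕ) (f : Fin (m + 1) → Fin t) (x : Fin t) :
    ZigzagMono (m + 2) t (Fin.snoc (α := fun _ => Fin t) f x) ↔
      ZigzagMono (m + 1) t f ∧ rel m (f (Fin.last m)) x := by
  have key : ∀ j (h : j < m + 1),
      (Fin.snoc (α := fun _ => Fin t) f x : Fin (m + 2) → Fin t) ⟨j, by omega⟩ = f ⟨j, h⟩ := by
    intro j h
    simp [Fin.snoc, h]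
  have key2 : (Fin.snoc (α := fun _ => Fin t) f x : Fin (m + 2) → Fin t) ⟨m + 1, by omega⟩ = x := by
    simp [Fin.snoc]
  constructor
  · intro H
    constructor
    · intro j h
      have := H j (by omega)
      rw [key j (by omega), key (j + 1) h] at this
      exact this
    · have := H m (by omega)
      rw [key m (by omega), key2] at this
      exact this
  · rintro ⟨H1, H2⟩ j h
    by_cases hj : j = m
    · subst hj
      rw [key j (by omega), key2]
      exact H2
    · rw [key j (by omega), key (j + 1) (by omega)]
      exact H1 j (by omega)

open Classical in
theorem sum_rel (t m : ℕ) (x : Fin t) :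
    ∑ j : Fin t, (if rel m j x then a t m j else 0) = a t (m + 1) x := by
  rw [Fin.sum_univ_eq_sum_range (fun j => if rel m j x then a t m j else 0), ← Finset.sum_filter]
  have hx := x.2
  rw [a]
  unfold rel
  split_ifs with h
  · apply Finset.sum_congr _ (fun _ _ => rfl)
    ext j; simp; omega
  · apply Finset.sum_congr _ (fun _ _ => rfl)
    ext j; simp; omega

open Classical in
theorem sum_zig (t m : ℕ) : ∀ g : Fin t → ℕ,
    ∑ f : Fin (m + 1) → Fin t, (if ZigzagMono (m + 1) t f then g (f (Fin.last m)) else 0)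
      = ∑ i : Fin t, a t m i * g i := by
  induction m with
  | zero =>
    intro g
    rw [← (Equiv.funUnique (Fin 1) (Fin t)).symm.sum_comp]
    apply Finset.sum_congr rfl
    intro i _
    rw [if_pos]
    · simp [a]
    · intro j h; omega
  | succ m ih =>
    intro g
    rw [← (Fin.snocEquiv (fun _ : Fin (m + 2) => Fin t)).sum_comp, Fintype.sum_prod_type_right]
    have h1 : ∀ f : Fin (m + 1) → Fin t, ∀ x : Fin t,
        (if ZigzagMono (m + 2) t (Fin.snocEquiv (fun _ : Fin (m + 2) => Fin t) (x, f)) then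
          g (Fin.snocEquiv (fun _ : Fin (m + 2) => Fin t) (x, f) (Fin.last (m + 1))) else 0)
        = if ZigzagMono (m + 1) t f then (if rel m (f (Fin.last m)) x then g x else 0) else 0 := by
      intro f x
      have e : Fin.snocEquiv (fun _ : Fin (m + 2) => Fin t) (x, f)
        = Fin.snoc (α := fun _ => Fin t) f x := rfl
      rw [e, ← ite_and]
      simp only [zig_snoc, Fin.snoc_last]
    have h2 : ∀ f : Fin (m + 1) → Fin t,
        ∑ x : Fin t, (if ZigzagMono (m + 1) t f then
          (if rel m (f (Fin.last m)) x then g x else 0) else 0)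
        = if ZigzagMono (m + 1) t f then
          (fun y : Fin t => ∑ x : Fin t, if rel m y x then g x else 0) (f (Fin.last m)) else 0 := by
      intro f
      split_ifs <;> simp
    refine (Finset.sum_congr rfl fun f _ =>
      (Finset.sum_congr rfl fun x _ => h1 f x).trans (h2 f)).trans ?_
    refine (ih (fun y : Fin t => ∑ x : Fin t, if rel m y x then g x else 0)).trans ?_
    simp only [Finset.mul_sum]
    rw [Finset.sum_comm]
    apply Finset.sum_congr rfl
    intro x _
    rw [← sum_rel, Finset.sum_mul]
    apply Finset.sum_congr rfl
    intro j _
    split_ifs <;> simp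

theorem card_zig (t m : ℕ) :
    Nat.card {f : Fin (m + 1) → Fin t // ZigzagMono (m + 1) t f}
      = ∑ i ∈ Finset.range t, a t m i := by
  classical
  have := sum_zig t m (fun _ => 1)
  rw [Nat.card_eq_fintype_card, Fintype.card_subtype, Finset.card_filter, this]
  simp [Fin.sum_univ_eq_sum_range]

theorem card_zig_zero (t : ℕ) :
    Nat.card {f : Fin 0 → Fin t // ZigzagMono 0 t f} = 1 := by
  rw [Nat.card_eq_one_iff_unique]
  refine ⟨⟨fun x y => Subtype.ext (Subsingleton.elim _ _)⟩, ⟨⟨Fin.elim0, ?_⟩⟩⟩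
  intro j h; omega

theorem card_even (s n : ℕ) :
    Nat.card {f : Fin (2 * n) → Fin (s + 1) // ZigzagMono (2 * n) (s + 1) f}
      = a (s + 1) (2 * n) s := by
  cases n with
  | zero => exact card_zig_zero _
  | succ n =>
    refine (card_zig (s + 1) (2 * n + 1)).trans ?_
    change _ = a (s + 1) ((2 * n + 1) + 1) s
    conv_rhs => rw [a]
    rw [if_pos (by simp)]

/-- odd-length series. -/
noncomputable def P (t i : ℕ) : PowerSeries ℚ := PowerSeries.mk fun n => (a t (2 * n) i : ℚ)
/-- even-length series. -/
noncomputable def Q (t i : ℕ) : PowerSeries ℚ := PowerSeries.mk fun n => (a t (2 * n + 1) i : ℚ)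
/-- denominators. -/
noncomputable def D (k : ℕ) : PowerSeries ℚ :=
  PowerSeries.mk fun j => (-1) ^ j * ((k + j).choose (2 * j) : ℚ)
/-- second denominators. -/
noncomputable def S (k : ℕ) : PowerSeries ℚ :=
  PowerSeries.mk fun j => (-1) ^ j * ((k + j).choose (2 * j + 1) : ℚ)

theorem a_odd (t n i : ℕ) : a t (2 * n + 1) i = ∑ j ∈ Finset.Ico i t, a t (2 * n) j := by
  rw [a, if_neg (by simp)]

theorem a_even (t n i : ℕ) :
    a t (2 * (n + 1)) i = ∑ j ∈ Finset.range (i + 1), a t (2 * n + 1) j := by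
  change a t ((2 * n + 1) + 1) i = _
  rw [a, if_pos (by simp)]

theorem Q_top (t : ℕ) : Q t t = 0 := by
  ext n; simp [Q, a_odd]

theorem Q_step (t i : ℕ) (h : i < t) : Q t i = Q t (i + 1) + P t i := by
  ext n
  simp only [Q, P, PowerSeries.coeff_mk, map_add, a_odd]
  rw [Finset.sum_eq_sum_Ico_succ_bot h]
  push_cast; ring

theorem P_step (t i : ℕ) : P t (i + 1) = P t i + PowerSeries.X * Q t (i + 1) := by
  ext n
  cases n with
  | zero => simp [P, a]
  | succ n =>
    rw [map_add, PowerSeries.coeff_succ_X_mul]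
    simp only [Q, P, PowerSeries.coeff_mk]
    rw [a_even, a_even, Finset.sum_range_succ]
    push_cast; ring

theorem P_zero (t : ℕ) : P t 0 = 1 + PowerSeries.X * Q t 0 := by
  ext n
  cases n with
  | zero => simp [P, a]
  | succ n =>
    rw [map_add, PowerSeries.coeff_succ_X_mul]
    simp only [Q, P, PowerSeries.coeff_mk]
    rw [a_even]
    simp [PowerSeries.coeff_one]

theorem S_step (k : ℕ) : S (k + 1) = S k + D k := by
  ext j
  simp only [S, D, PowerSeries.coeff_mk, map_add]
  rw [show k + 1 + j = (k + j) + 1 by ring, Nat.choose_succ_succ]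
  push_cast; ring

theorem D_step (k : ℕ) : D (k + 1) = D k - PowerSeries.X * S (k + 1) := by
  ext j
  cases j with
  | zero => simp [D]
  | succ j =>
    rw [map_sub, PowerSeries.coeff_succ_X_mul]
    simp only [S, D, PowerSeries.coeff_mk]
    rw [show k + 1 + (j + 1) = (k + 1 + j) + 1 by ring, show 2 * (j + 1) = (2 * j + 1) + 1 by ring,
      Nat.choose_succ_succ, show k + (j + 1) = k + 1 + j by ring]
    push_cast; ring

theorem D_zero : D 0 = 1 := by
  ext j
  cases j with
  | zero => simp [D]
  | succ j =>
    simp only [D, PowerSeries.coeff_mk, PowerSeries.coeff_one]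
    rw [Nat.choose_eq_zero_of_lt (by omega)]
    simp

theorem S_zero : S 0 = 0 := by
  ext j
  simp only [S, PowerSeries.coeff_mk]
  rw [Nat.choose_eq_zero_of_lt (by omega)]
  simp

theorem PQ (s k : ℕ) (h : k ≤ s) :
    P (s + 1) (s - k) = P (s + 1) s * D k ∧ Q (s + 1) (s - k) = P (s + 1) s * S (k + 1) := by
  induction k with
  | zero =>
    refine ⟨by simp [D_zero], ?_⟩
    rw [Nat.sub_zero, Q_step _ _ (Nat.lt_succ_self s), Q_top, S_step, S_zero, D_zero]
    ring
  | succ k ih =>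
    obtain ⟨h1, h2⟩ := ih (by omega)
    have e : s - k = s - (k + 1) + 1 := by omega
    have h3 : P (s + 1) (s - (k + 1)) = P (s + 1) s * D (k + 1) := by
      have := P_step (s + 1) (s - (k + 1))
      rw [← e, h1, h2] at this
      rw [D_step]
      linear_combination -this
    refine ⟨h3, ?_⟩
    rw [Q_step _ _ (by omega), ← e, h2, h3, S_step (k + 1)]
    ring

theorem main_nat (s : ℕ) : D (s + 1) * P (s + 1) s = 1 := by
  obtain ⟨h1, h2⟩ := PQ s s le_rfl
  have h3 := P_zero (s + 1)
  rw [Nat.sub_self] at h1 h2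
  rw [h1, h2] at h3
  rw [D_step]
  linear_combination h3

/-- denominators as polynomials. -/
noncomputable def d (k : ℕ) : ℚ[X] :=
  C ((-1) ^ k / ((2 * k).factorial : ℚ)) *
    ∏ i ∈ Finset.range k, ((X + C ((i : ℚ) + 1)) * (X - C (i : ℚ)))

theorem d_prod (t : ℚ) (k : ℕ) :
    ∏ i ∈ Finset.range k, ((t + ((i : ℚ) + 1)) * (t - (i : ℚ)))
      = ∏ i ∈ Finset.range (2 * k), (t + k - i) := by
  induction k with
  | zero => simp
  | succ k ih =>
    rw [Finset.prod_range_succ, ih, show 2 * (k + 1) = 2 * k + 1 + 1 by ring,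
      Finset.prod_range_succ, Finset.prod_range_succ']
    have : ∀ i : ℕ, t + ((k + 1 : ℕ) : ℚ) - ((i + 1 : ℕ) : ℚ) = t + k - i := by
      intro i; push_cast; ring
    simp only [this]
    push_cast; ring

theorem d_eval (t k : ℕ) : (d k).eval (t : ℚ) = (-1) ^ k * ((t + k).choose (2 * k) : ℚ) := by
  have h : ∏ i ∈ Finset.range (2 * k), ((t : ℚ) + k - i) = ((t + k).descFactorial (2 * k) : ℚ) := by
    rw [← descPochhammer_eval_eq_descFactorial, descPochhammer_eval_eq_prod_range]
    push_cast; rfl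
  have h2 : ((2 * k).factorial : ℚ) ≠ 0 := by positivity
  simp only [d, eval_mul, eval_C, eval_prod, eval_add, eval_sub, eval_X]
  rw [d_prod, h, Nat.descFactorial_eq_factorial_mul_choose]
  push_cast
  field_simp

theorem main_poly (Ω : ℕ → Polynomial ℚ)
    (hΩ : ∀ m t : ℕ, 0 < t →
      (Ω m).eval (t : ℚ) = (Nat.card {f : Fin m → Fin t // ZigzagMono m t f} : ℚ)) :
    (PowerSeries.mk d) * (PowerSeries.mk fun n => Ω (2 * n)) = 1 := by
  ext1 n
  have hs : ∀ s : ℕ, (PowerSeries.coeff n ((PowerSeries.mk d) *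
      (PowerSeries.mk fun n => Ω (2 * n)))).eval (((s + 1 : ℕ)) : ℚ)
      = (PowerSeries.coeff n (1 : PowerSeries ℚ[X])).eval (((s + 1 : ℕ)) : ℚ) := by
    intro s
    have h := congrArg (PowerSeries.coeff n) (main_nat s)
    rw [PowerSeries.coeff_mul] at h ⊢
    rw [eval_finsetSum]
    simp only [PowerSeries.coeff_mk, eval_mul, d_eval, hΩ _ _ (Nat.succ_pos s), card_even]
    simp only [D, P, PowerSeries.coeff_mk] at h
    rw [h, PowerSeries.coeff_one, PowerSeries.coeff_one]
    split_ifs <;> simp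
  apply Polynomial.eq_of_infinite_eval_eq
  refine Set.Infinite.mono ?_ (Set.infinite_range_of_injective
    (f := fun s : ℕ => (((s + 1 : ℕ)) : ℚ)) ?_)
  · rintro _ ⟨s, rfl⟩
    exact hs s
  · intro x y hxy
    have : x + 1 = y + 1 := Nat.cast_injective (R := ℚ) hxy
    omega

theorem d_shift (k : ℕ) : (d k).comp (X - C (1 / 2)) =
    C ((-1) ^ k / ((2 * k).factorial : ℚ)) *
    ∏ i ∈ Finset.range k, (X ^ 2 - C (((i : ℚ) + 1 / 2) ^ 2)) := by
  rw [d, mul_comp, C_comp, prod_comp]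
  congr 1
  apply Finset.prod_congr rfl
  intro i _
  simp only [mul_comp, add_comp, sub_comp, X_comp, C_comp]
  have e1 : (X : ℚ[X]) - C (1 / 2) + C ((i : ℚ) + 1) = X + C ((i : ℚ) + 1 / 2) := by
    rw [show (i : ℚ) + 1 = (i + 1 / 2) + 1 / 2 by ring, C_add (a := (i : ℚ) + 1 / 2)]; ring
  have e2 : (X : ℚ[X]) - C (1 / 2) - C (i : ℚ) = X - C ((i : ℚ) + 1 / 2) := by
    rw [C_add]; ring
  rw [e1, e2, C_pow]; ring

theorem d_shift_even (k : ℕ) :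
    ((d k).comp (X - C (1 / 2))).comp (-X) = (d k).comp (X - C (1 / 2)) := by
  rw [d_shift, mul_comp, C_comp, prod_comp]
  simp

theorem d_shift_zero (k : ℕ) :
    ((d k).comp (X - C (1 / 2))).eval 0 = (Nat.centralBinom k : ℚ) / 16 ^ k := by
  rw [d_shift]
  simp only [eval_mul, eval_C, eval_prod, eval_sub, eval_pow, eval_X]
  induction k with
  | zero => simp
  | succ k ih =>
    rw [Finset.prod_range_succ]
    have h := Nat.succ_mul_centralBinom_succ k
    have h' : ((k : ℚ) + 1) * (Nat.centralBinom (k + 1) : ℚ)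
      = 2 * (2 * k + 1) * Nat.centralBinom k := by exact_mod_cast h
    have hk : (k : ℚ) + 1 ≠ 0 := by positivity
    have h'' : (Nat.centralBinom (k + 1) : ℚ) = 2 * (2 * k + 1) * Nat.centralBinom k / (k + 1) := by
      rw [← h']; field_simp
    have hf : ((2 * (k + 1)).factorial : ℚ) = (2 * k + 2) * ((2 * k + 1) * (2 * k).factorial) := by
      rw [show 2 * (k + 1) = 2 * k + 1 + 1 by ring, Nat.factorial_succ, Nat.factorial_succ]
      push_cast; ring
    have h2 : ((2 * k).factorial : ℚ) ≠ 0 := by positivity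
    have h3 : (2 * (k : ℚ) + 1) ≠ 0 := by positivity
    have h4 : (2 * (k : ℚ) + 2) ≠ 0 := by positivity
    have ih' : ∏ i ∈ Finset.range k, ((0 : ℚ) ^ 2 - ((i : ℚ) + 1 / 2) ^ 2)
        = (-1 : ℚ) ^ k * ((2 * k).factorial : ℚ) * ((Nat.centralBinom k : ℚ) / 16 ^ k) := by
      rw [← ih]
      have : ((-1 : ℚ) ^ k) * (-1) ^ k = 1 := by rw [← mul_pow]; simp
      generalize ∏ i ∈ Finset.range k, ((0 : ℚ) ^ 2 - ((i : ℚ) + 1 / 2) ^ 2) = z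
      rw [show (-1 : ℚ) ^ k * (2 * k).factorial * ((-1) ^ k / (2 * k).factorial * z)
        = ((-1 : ℚ) ^ k * (-1) ^ k) * ((2 * k).factorial / (2 * k).factorial) * z by ring, this,
        div_self h2]
      ring
    rw [ih', h'', hf]
    have : ((-1 : ℚ) ^ k) * (-1) ^ k = 1 := by rw [← mul_pow]; simp
    rw [show (-1 : ℚ) ^ (k + 1) / ((2 * k + 2) * ((2 * k + 1) * (2 * k).factorial)) *
      ((-1) ^ k * (2 * k).factorial * (Nat.centralBinom k / 16 ^ k) * (0 ^ 2 - ((k : ℚ) + 1 / 2) ^ 2))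
      = (((-1 : ℚ) ^ k) * (-1) ^ k) * (1 / ((2 * k + 2) * ((2 * k + 1) * (2 * k).factorial)) *
      ((2 * k).factorial * (Nat.centralBinom k / 16 ^ k) * (((k : ℚ) + 1 / 2) ^ 2))) by ring, this]
    field_simp
    ring

/-- central binomials over 16^k. -/
noncomputable def B : PowerSeries ℚ := PowerSeries.mk fun k => (Nat.centralBinom k : ℚ) / 16 ^ k
/-- the target series. -/
noncomputable def R : PowerSeries ℚ := PowerSeries.mk fun n => if n = 0 then 1 else
  -(1 / 16 ^ n : ℚ) * (2 / n) * (Nat.choose (2 * n - 2) (n - 1) : ℚ)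

theorem R_succ (n : ℕ) : PowerSeries.coeff (n + 1) R
    = -(1 / 16 ^ (n + 1) : ℚ) * (2 / (n + 1)) * Nat.centralBinom n := by
  simp only [R, PowerSeries.coeff_mk, Nat.succ_ne_zero, if_false]
  rw [Nat.centralBinom, show 2 * (n + 1) - 2 = 2 * n by omega]
  simp

open PowerSeries in
theorem B_ode : (1 - PowerSeries.C (1 / 4 : ℚ) * PowerSeries.X) * (d⁄dX ℚ) B
    = PowerSeries.C (1 / 8 : ℚ) * B := by
  ext n
  have h' : ((n : ℚ) + 1) * (Nat.centralBinom (n + 1) : ℚ)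
      = 2 * (2 * n + 1) * Nat.centralBinom n := by exact_mod_cast Nat.succ_mul_centralBinom_succ n
  rw [sub_mul, one_mul, mul_assoc, map_sub, PowerSeries.coeff_C_mul, PowerSeries.coeff_C_mul]
  cases n with
  | zero => simp [PowerSeries.coeff_derivative, B, Nat.centralBinom]; norm_num [Nat.choose]
  | succ n =>
    rw [PowerSeries.coeff_succ_X_mul, PowerSeries.coeff_derivative, PowerSeries.coeff_derivative]
    simp only [B, PowerSeries.coeff_mk]
    push_cast at h' ⊢
    field_simp
    ring_nf at h' ⊢
    linear_combination 512 * 16 ^ n * h'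

open PowerSeries in
theorem R_ode : (1 - PowerSeries.C (1 / 4 : ℚ) * PowerSeries.X) * (d⁄dX ℚ) R
    = - PowerSeries.C (1 / 8 : ℚ) * R := by
  ext n
  rw [sub_mul, one_mul, mul_assoc, map_sub, PowerSeries.coeff_C_mul, neg_mul, map_neg,
    PowerSeries.coeff_C_mul]
  cases n with
  | zero =>
    rw [PowerSeries.coeff_derivative, R_succ]
    simp [R]; norm_num
  | succ n =>
    have h' : ((n : ℚ) + 1) * (Nat.centralBinom (n + 1) : ℚ)
      = 2 * (2 * n + 1) * Nat.centralBinom n := by exact_mod_cast Nat.succ_mul_centralBinom_succ n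
    rw [PowerSeries.coeff_succ_X_mul, PowerSeries.coeff_derivative, PowerSeries.coeff_derivative,
      R_succ, R_succ]
    have h2 : (n : ℚ) + 1 ≠ 0 := by positivity
    have h3 : (n : ℚ) + 1 + 1 ≠ 0 := by positivity
    have h'' : (Nat.centralBinom (n + 1) : ℚ) = 2 * (2 * n + 1) * Nat.centralBinom n / (n + 1) := by
      rw [← h']; field_simp
    rw [h'']
    push_cast
    field_simp
    ring

open PowerSeries in
theorem BR : B * R = 1 := by
  apply PowerSeries.derivative.ext
  · have h : (1 - PowerSeries.C (1 / 4 : ℚ) * PowerSeries.X) * (d⁄dX ℚ) (B * R) = 0 := by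
      rw [Derivation.leibniz, smul_eq_mul, smul_eq_mul]
      linear_combination B * R_ode + R * B_ode
    have hne : (1 - PowerSeries.C (1 / 4 : ℚ) * PowerSeries.X) ≠ 0 := by
      intro h0
      have := congrArg (PowerSeries.constantCoeff) h0
      simp at this
    rw [(mul_eq_zero.mp h).resolve_left hne]
    simp
  · simp [B, R]

end ZZ

/-- for `n ≥ 1`, the polynomial `Ω(Z_{2n}; t − 1/2)` has linear
coefficient `0` and constant coefficient
`R_{2n} = −(1/16ⁿ)·(2/n)·binom(2n−2, n−1)`. -/
theorem zigzag_even_shifted_constant_and_linear_coeff (Ω : ℕ → Polynomial ℚ)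
    (hΩ : ∀ m t : ℕ, 0 < t →
      (Ω m).eval (t : ℚ) = (Nat.card {f : Fin m → Fin t // ZigzagMono m t f} : ℚ))
    (n : ℕ) (hn : 1 ≤ n) :
    ((Ω (2 * n)).comp (X - C (1 / 2))).coeff 1 = 0 ∧
    ((Ω (2 * n)).comp (X - C (1 / 2))).coeff 0 =
      -(1 / 16 ^ n : ℚ) * (2 / n) * (Nat.choose (2 * n - 2) (n - 1) : ℚ) := by
  set W : PowerSeries ℚ[X] := PowerSeries.mk fun n => (Ω (2 * n)).comp (X - C (1 / 2)) with hW
  set A : PowerSeries ℚ[X] := PowerSeries.mk fun n => (ZZ.d n).comp (X - C (1 / 2)) with hA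
  have hAW : A * W = 1 := by
    have h := congrArg (PowerSeries.map (compRingHom (X - C (1 / 2 : ℚ)))) (ZZ.main_poly Ω hΩ)
    rw [map_mul, map_one] at h
    rw [← h]
    congr 1 <;> (ext1 m; simp [hA, hW])
  constructor
  · have h := congrArg (PowerSeries.map (compRingHom (-X : ℚ[X]))) hAW
    rw [map_mul, map_one] at h
    have hA' : PowerSeries.map (compRingHom (-X : ℚ[X])) A = A := by
      ext1 m
      rw [PowerSeries.coeff_map, hA, PowerSeries.coeff_mk, coe_compRingHom_apply]
      exact ZZ.d_shift_even m
    rw [hA'] at h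
    have hWW : PowerSeries.map (compRingHom (-X : ℚ[X])) W = W := by
      linear_combination (-PowerSeries.map (compRingHom (-X : ℚ[X])) W) * hAW + W * h
    have h1 := congrArg (fun p => (PowerSeries.coeff n p).coeff 1) hWW
    simp only [PowerSeries.coeff_map, hW, PowerSeries.coeff_mk, coe_compRingHom_apply] at h1
    rw [show (-X : ℚ[X]) = C (-1) * X by simp, comp_C_mul_X_coeff] at h1
    linarith
  · have h := congrArg (PowerSeries.map (evalRingHom (0 : ℚ))) hAW
    rw [map_mul, map_one] at h
    have hA' : PowerSeries.map (evalRingHom (0 : ℚ)) A = ZZ.B := by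
      ext1 m
      rw [PowerSeries.coeff_map, hA, PowerSeries.coeff_mk, coe_evalRingHom, ZZ.B,
        PowerSeries.coeff_mk]
      exact ZZ.d_shift_zero m
    rw [hA'] at h
    have hWW : PowerSeries.map (evalRingHom (0 : ℚ)) W = ZZ.R := by
      linear_combination (-PowerSeries.map (evalRingHom (0 : ℚ)) W) * ZZ.BR + ZZ.R * h
    have h1 := congrArg (PowerSeries.coeff n) hWW
    rw [PowerSeries.coeff_map, hW, PowerSeries.coeff_mk, coe_evalRingHom, ZZ.R,
      PowerSeries.coeff_mk, if_neg (by omega)] at h1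
    rw [coeff_zero_eq_eval_zero]
    exact h1
end

section
/- For every integer n ≥ 2, the coefficient of t^{n−2} in the polynomial Ω(Z_n; t − 1/2) equals (n − 5) · E_{n−2} / (24 · (n−2)!). -/
open Polynomial

/-- The Euler number `E_k`: the number of alternating permutations `σ` of `{1,…,k}`
with `σ(1) > σ(2) < σ(3) > ⋯`; equivalently the number of linear extensions of `Z_k`. -/
noncomputable def EulerNumber (k : ℕ) : ℕ :=
  Nat.card {σ : Equiv.Perm (Fin k) // ∀ i : ℕ, (h : i + 1 < k) →
    if Even i then σ ⟨i + 1, h⟩ < σ ⟨i, Nat.lt_of_succ_lt h⟩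
    else σ ⟨i, Nat.lt_of_succ_lt h⟩ < σ ⟨i + 1, h⟩}


theorem exists_antideriv (p : ℚ[X]) : ∃ q : ℚ[X], derivative q = p ∧ q.eval 0 = 0 := by
  induction p using Polynomial.induction_on' with
  | add p q hp hq =>
    obtain ⟨a, ha, ha'⟩ := hp
    obtain ⟨b, hb, hb'⟩ := hq
    exact ⟨a + b, by simp [ha, hb], by simp [ha', hb']⟩
  | monomial n a =>
    refine ⟨monomial (n+1) (a / (n+1)), ?_, ?_⟩
    · rw [derivative_monomial]
      have : ((n:ℚ)+1) ≠ 0 := by positivity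
      simp
      field_simp
    · simp

noncomputable def adv (p : ℚ[X]) : ℚ[X] := (exists_antideriv p).choose
theorem adv_d (p : ℚ[X]) : derivative (adv p) = p := (exists_antideriv p).choose_spec.1
theorem adv_0 (p : ℚ[X]) : (adv p).eval 0 = 0 := (exists_antideriv p).choose_spec.2

noncomputable def ww : ℕ → ℚ[X]
  | 0 => 1
  | n+1 => adv ((ww n).comp (1 - X))

theorem ww_d (n : ℕ) : derivative (ww (n+1)) = (ww n).comp (1 - X) := by rw [ww, adv_d]
theorem ww_0 (n : ℕ) : (ww (n+1)).eval 0 = 0 := by rw [ww, adv_0]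
theorem comp_flip (p : ℚ[X]) : (p.comp (1 - X)).comp (1 - X) = p := by
  rw [comp_assoc]; simp
theorem ww_dd (n : ℕ) : derivative (derivative (ww (n+2))) = - ww n := by
  rw [ww_d, derivative_comp, ww_d, comp_flip]; simp

noncomputable def cc : ℕ → ℚ[X]
  | 0 => 0
  | 1 => 0
  | n+2 => C ((n:ℚ)/24) * ww n

theorem cc_0 (n : ℕ) : (cc (n+1)).eval 0 = 0 := by
  rcases n with _ | _ | n
  · simp [cc]
  · simp [cc]
  · simp [cc, ww_0]

theorem cc_d (n : ℕ) : derivative (cc (n+1)) + C (1/24) * derivative (derivative (derivative (ww (n+1)))) = (cc n).comp (1 - X) := by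
  rcases n with _ | _ | n
  · rw [ww_d 0]; simp [cc, ww]
  · rw [ww_dd 0]; simp [cc, ww]
  · rw [ww_dd (n+1)]
    simp only [cc, derivative_neg, ww_d, derivative_mul, derivative_C, mul_comp, C_comp]
    have : C ((((n+1 : ℕ):ℚ))/24) = C ((n:ℚ)/24) + C (1/24) := by
      rw [← C_add]; congr 1; push_cast; ring
    rw [this]; ring

theorem bdd (p : ℚ[X]) : ∃ K : ℚ, 0 ≤ K ∧ ∀ y : ℚ, |y| ≤ 1 → |p.eval y| ≤ K := by
  induction p using Polynomial.induction_on' with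
  | add p q hp hq =>
    obtain ⟨a, ha, ha'⟩ := hp
    obtain ⟨b, hb, hb'⟩ := hq
    refine ⟨a + b, by positivity, fun y hy => ?_⟩
    rw [eval_add]
    exact (abs_add_le _ _).trans (add_le_add (ha' y hy) (hb' y hy))
  | monomial n a =>
    refine ⟨|a|, by positivity, fun y hy => ?_⟩
    rw [eval_monomial, abs_mul, abs_pow]
    exact mul_le_of_le_one_right (abs_nonneg _) (pow_le_one₀ (abs_nonneg _) hy)

theorem taylor4 (p : ℚ[X]) : ∃ K : ℚ, 0 ≤ K ∧ ∀ y h : ℚ, |y| ≤ 1 → |h| ≤ 1 →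
    |p.eval (y+h) - (p.eval y + h * (derivative p).eval y + h^2/2 * (derivative (derivative p)).eval y
      + h^3/6 * (derivative (derivative (derivative p))).eval y)| ≤ K * |h|^4 := by
  induction p using Polynomial.induction_on with
  | C a => exact ⟨0, le_rfl, fun y h _ _ => by simp⟩
  | add p q hp hq =>
    obtain ⟨a, ha, ha'⟩ := hp
    obtain ⟨b, hb, hb'⟩ := hq
    refine ⟨a + b, by positivity, fun y h hy hh => ?_⟩
    have := (abs_add_le _ _).trans (add_le_add (ha' y h hy hh) (hb' y h hy hh))
    rw [add_mul]
    refine le_trans (le_of_eq ?_) this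
    congr 1
    simp only [derivative_add, eval_add]; ring
  | monomial n a ih =>
    have e : (C a * X^(n+1) : ℚ[X]) = (C a * X^n) * X := by ring
    rw [e]
    generalize (C a * X^n : ℚ[X]) = p at ih
    obtain ⟨K, hK, h1⟩ := ih
    obtain ⟨B, hB, h2⟩ := bdd (derivative (derivative (derivative p)))
    refine ⟨2 * K + B, by positivity, fun y h hy hh => ?_⟩
    have h1 := h1 y h hy hh
    have h2 := h2 y hy
    simp only [derivative_mul, derivative_add, derivative_X, eval_add, eval_mul, eval_X, mul_one]
    set R := p.eval (y+h) - (p.eval y + h * (derivative p).eval y + h^2/2 * (derivative (derivative p)).eval y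
      + h^3/6 * (derivative (derivative (derivative p))).eval y) with hR
    set D := (derivative (derivative (derivative p))).eval y
    have hyh : |y+h| ≤ 2 := (abs_add_le _ _).trans (by linarith)
    have e1 : |(y+h) * R + D/6 * h^4| ≤ (2*K + B) * |h|^4 := by
      refine (abs_add_le _ _).trans ?_
      rw [abs_mul, abs_mul, abs_pow, abs_div]
      have : |y+h| * |R| ≤ 2 * (K * |h|^4) := by gcongr
      have : |D|/|6| * |h|^4 ≤ B * |h|^4 := by
        gcongr
        rw [abs_of_pos (by norm_num : (0:ℚ) < 6)]
        have := abs_nonneg D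
        linarith
      linarith
    refine le_trans (le_of_eq ?_) e1
    congr 1
    rw [hR]
    ring

theorem taylor3 (p : ℚ[X]) : ∃ K : ℚ, 0 ≤ K ∧ ∀ y h : ℚ, |y| ≤ 1 → |h| ≤ 1 →
    |p.eval (y+h) - (p.eval y + h * (derivative p).eval y + h^2/2 * (derivative (derivative p)).eval y)| ≤ K * |h|^3 := by
  obtain ⟨K, hK, h1⟩ := taylor4 p
  obtain ⟨B, hB, h2⟩ := bdd (derivative (derivative (derivative p)))
  refine ⟨K + B, by positivity, fun y h hy hh => ?_⟩
  have h1 := h1 y h hy hh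
  have h2 := h2 y hy
  set D := (derivative (derivative (derivative p))).eval y
  have : |h^3/6 * D| ≤ B * |h|^3 := by
    rw [abs_mul, abs_div, abs_pow, abs_of_pos (by norm_num : (0:ℚ) < 6)]
    have : 0 ≤ |h|^3 := by positivity
    nlinarith [abs_nonneg D]
  have h3 : |h|^4 ≤ |h|^3 := pow_le_pow_of_le_one (abs_nonneg _) hh (by norm_num)
  have h4 : K * |h|^4 ≤ K * |h|^3 := by gcongr
  rw [abs_le] at *
  constructor <;> linarith

theorem taylor2 (p : ℚ[X]) : ∃ K : ℚ, 0 ≤ K ∧ ∀ y h : ℚ, |y| ≤ 1 → |h| ≤ 1 →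
    |p.eval (y+h) - (p.eval y + h * (derivative p).eval y)| ≤ K * |h|^2 := by
  obtain ⟨K, hK, h1⟩ := taylor3 p
  obtain ⟨B, hB, h2⟩ := bdd (derivative (derivative p))
  refine ⟨K + B, by positivity, fun y h hy hh => ?_⟩
  have h1 := h1 y h hy hh
  have h2 := h2 y hy
  set D := (derivative (derivative p)).eval y
  have : |h^2/2 * D| ≤ B * |h|^2 := by
    rw [abs_mul, abs_div, abs_pow, abs_of_pos (by norm_num : (0:ℚ) < 2)]
    have : 0 ≤ |h|^2 := by positivity
    nlinarith [abs_nonneg D]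
  have h3 : |h|^3 ≤ |h|^2 := pow_le_pow_of_le_one (abs_nonneg _) hh (by norm_num)
  have h4 : K * |h|^3 ≤ K * |h|^2 := by gcongr
  rw [abs_le] at *
  constructor <;> linarith

theorem taylor1 (p : ℚ[X]) : ∃ K : ℚ, 0 ≤ K ∧ ∀ y h : ℚ, |y| ≤ 1 → |h| ≤ 1 →
    |p.eval (y+h) - p.eval y| ≤ K * |h| := by
  obtain ⟨K, hK, h1⟩ := taylor2 p
  obtain ⟨B, hB, h2⟩ := bdd (derivative p)
  refine ⟨K + B, by positivity, fun y h hy hh => ?_⟩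
  have h1 := h1 y h hy hh
  have h2 := h2 y hy
  set D := (derivative p).eval y
  have : |h * D| ≤ B * |h| := by
    rw [abs_mul]
    nlinarith [abs_nonneg D, abs_nonneg h]
  have h3 : |h|^2 ≤ |h| := by nlinarith [abs_nonneg h]
  have h4 : K * |h|^2 ≤ K * |h| := by gcongr
  rw [abs_le] at *
  constructor <;> linarith

def WW (t : ℕ) : ℕ → ℕ → ℕ
  | 0, _ => 1
  | n+1, k => ∑ j ∈ Finset.range k, WW t n (t - j)

theorem WW_bound (n : ℕ) : ∃ K : ℚ, 0 ≤ K ∧ ∀ t k : ℕ, 0 < t → k ≤ t → ∀ s : ℚ, s = t + 1/2 →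
    |(WW t n k : ℚ) - s^n * ((ww n).eval (k/s) + (cc n).eval (k/s) / s^2)| ≤ K * (s^n / s^3) := by
  induction n with
  | zero => exact ⟨0, le_rfl, fun t k _ _ s _ => by simp [WW, ww, cc]⟩
  | succ n ih =>
    obtain ⟨K, hK, ih⟩ := ih
    obtain ⟨A, hA, hw⟩ := taylor4 (ww (n+1))
    obtain ⟨B, hB, hc⟩ := taylor2 (cc (n+1))
    refine ⟨K + A + B, by positivity, fun t k ht hk s hs => ?_⟩
    have ht1 : (1:ℚ) ≤ t := by exact_mod_cast ht
    have hs1 : 1 ≤ s := by rw [hs]; linarith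
    have hs0 : 0 < s := by linarith
    suffices H : ∀ k : ℕ, k ≤ t → |(WW t (n+1) k : ℚ) - s^(n+1) * ((ww (n+1)).eval (k/s) + (cc (n+1)).eval (k/s) / s^2)| ≤ k * ((K + A + B) * (s^n/s^3)) by
      refine (H k hk).trans ?_
      have : (k:ℚ) ≤ s := by
        have : (k:ℚ) ≤ t := by exact_mod_cast hk
        rw [hs]; linarith
      calc (k:ℚ) * ((K + A + B) * (s^n/s^3)) ≤ s * ((K + A + B) * (s^n/s^3)) := by gcongr
        _ = _ := by ring
    intro k
    induction k with
    | zero => intro _; simp [WW, ww_0, cc_0]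
    | succ k ihk =>
      intro hk
      have ihk := ihk (by omega)
      have ih := ih t (t-k) ht (by omega) s hs
      set h : ℚ := 1/(2*s) with hh
      set y : ℚ := (k + 1/2)/s with hy
      have hkt : (k:ℚ) + 1 ≤ t := by exact_mod_cast hk
      have e1 : ((k+1:ℕ):ℚ)/s = y + h := by rw [hy, hh]; push_cast; field_simp; ring
      have e2 : (k:ℚ)/s = y + -h := by rw [hy, hh]; field_simp; ring
      have e3 : ((t-k:ℕ):ℚ)/s = 1 - y := by
        rw [hy, Nat.cast_sub (by omega)]; field_simp; rw [hs]; ring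
      have hh0 : 0 < h := by positivity
      have hh1 : |h| ≤ 1 := by
        rw [abs_of_pos hh0, hh, div_le_one (by positivity)]; linarith
      have hy1 : |y| ≤ 1 := by
        rw [abs_of_nonneg (by positivity), hy, div_le_one hs0, hs]; linarith
      have w1 := hw y h hy1 hh1
      have w2 := hw y (-h) hy1 (by rwa [abs_neg])
      have c1 := hc y h hy1 hh1
      have c2 := hc y (-h) hy1 (by rwa [abs_neg])
      rw [abs_neg] at w2 c2
      rw [abs_of_pos hh0] at w1 w2 c1 c2
      have hd := congrArg (eval y) (cc_d n)
      have hd' := congrArg (eval y) (ww_d n)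
      simp only [eval_add, eval_mul, eval_C, eval_comp, eval_sub, eval_one, eval_X] at hd hd'
      rw [e3, ← hd, ← hd'] at ih
      rw [e1]
      rw [e2] at ihk
      have eW : (WW t (n+1) (k+1) : ℚ) = WW t (n+1) k + WW t n (t-k) := by
        simp only [WW, Finset.sum_range_succ]; push_cast; ring
      rw [eW]
      generalize (WW t (n+1) k : ℚ) = W1 at *
      generalize (WW t n (t-k) : ℚ) = W2 at *
      generalize eval (y+h) (ww (n+1)) = wp at *
      generalize eval (y+ -h) (ww (n+1)) = wm at *
      generalize eval (y+h) (cc (n+1)) = cp at *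
      generalize eval (y+ -h) (cc (n+1)) = cm at *
      generalize eval y (derivative (derivative (derivative (ww (n+1))))) = d3 at *
      generalize eval y ((derivative (derivative (ww (n+1))))) = d2 at *
      generalize eval y (((derivative (ww (n+1))))) = d1 at *
      generalize eval y (((((ww (n+1)))))) = d0 at *
      generalize eval y (((derivative (cc (n+1))))) = q1 at *
      generalize eval y (((((cc (n+1)))))) = q0 at *
      have hsh : s = 1/(2*h) := by rw [hh]; field_simp
      -- remainders
      have key : |(wp - wm - 2*h*d1 - h^3/3*d3) + (cp - cm - 2*h*q1) / s^2| ≤ (A + B) / s^4 := by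
        have hA4 : 2 * (A * h^4) ≤ A / s^4 := by
          rw [hh]; 
          have : 2 * (A * (1/(2*s))^4) = A / s^4 / 8 := by field_simp; ring
          rw [this]
          have : 0 ≤ A / s^4 := by positivity
          linarith
        have hB4 : 2 * (B * h^2) / s^2 ≤ B / s^4 := by
          rw [hh]; 
          have : 2 * (B * (1/(2*s))^2) / s^2 = B / s^4 / 2 := by field_simp
          rw [this]
          have : 0 ≤ B / s^4 := by positivity
          linarith
        have t1 : |wp - wm - 2*h*d1 - h^3/3*d3| ≤ 2 * (A * h^4) := by
          rw [abs_le] at *; constructor <;> linarith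
        have t2 : |cp - cm - 2*h*q1| ≤ 2 * (B * h^2) := by
          rw [abs_le] at *; constructor <;> linarith
        have t3 : |(cp - cm - 2*h*q1) / s^2| ≤ 2 * (B * h^2) / s^2 := by
          rw [abs_div, abs_of_pos (by positivity : 0 < s^2)]; gcongr
        refine (abs_add_le _ _).trans ?_
        rw [add_div]; linarith
      have key2 : |s^(n+1) * ((wp - wm - 2*h*d1 - h^3/3*d3) + (cp - cm - 2*h*q1) / s^2)| ≤ (A+B) * (s^n/s^3) := by
        rw [abs_mul, abs_of_pos (by positivity : 0 < s^(n+1))]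
        calc _ ≤ s^(n+1) * ((A + B) / s^4) := by gcongr
          _ = _ := by rw [pow_succ]; field_simp
      have e : W1 + W2 - s^(n+1) * (wp + cp/s^2) = (W1 - s^(n+1) * (wm + cm/s^2))
          + (W2 - s^n * (d1 + (q1 + 1/24*d3)/s^2)) - s^(n+1) * ((wp - wm - 2*h*d1 - h^3/3*d3) + (cp - cm - 2*h*q1) / s^2) := by
        rw [hh, pow_succ]; field_simp; ring
      rw [e]
      push_cast
      have e5 : ((k:ℚ)+1) * ((K+A+B) * (s^n/s^3)) = k * ((K+A+B) * (s^n/s^3)) + K * (s^n/s^3) + (A+B) * (s^n/s^3) := by ring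
      rw [e5]
      exact (abs_sub _ _).trans (add_le_add ((abs_add_le _ _).trans (add_le_add ihk ih)) key2)

theorem WW_asymp (n : ℕ) : ∃ K : ℚ, 0 ≤ K ∧ ∀ t : ℕ, 0 < t → ∀ s : ℚ, s = t + 1/2 →
    |(WW t (n+2) t : ℚ) - (s^(n+2) * (ww (n+2)).eval 1 + s^n * (((n:ℚ)-3)/24 * (ww n).eval 1))| ≤ K * (s^(n+2) / s^3) := by
  obtain ⟨K, hK, H⟩ := WW_bound (n+2)
  obtain ⟨A, hA, hw⟩ := taylor3 (ww (n+2))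
  obtain ⟨B, hB, hc⟩ := taylor1 (cc (n+2))
  refine ⟨K + A + B, by positivity, fun t ht s hs => ?_⟩
  have ht1 : (1:ℚ) ≤ t := by exact_mod_cast ht
  have hs1 : 1 ≤ s := by rw [hs]; linarith
  have hs0 : 0 < s := by linarith
  have H := H t t ht le_rfl s hs
  set h : ℚ := 1/(2*s) with hh
  have hh0 : 0 < h := by positivity
  have hh1 : |h| ≤ 1 := by
    rw [abs_of_pos hh0, hh, div_le_one (by positivity)]; linarith
  have e1 : (t:ℚ)/s = 1 + -h := by rw [hh]; field_simp; rw [hs]; ring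
  rw [e1] at H
  have w1 := hw 1 (-h) (by simp) (by rwa [abs_neg])
  have c1 := hc 1 (-h) (by simp) (by rwa [abs_neg])
  rw [abs_neg, abs_of_pos hh0] at w1 c1
  rw [ww_dd, ww_d] at w1
  have z : eval 1 ((ww (n+1)).comp (1-X)) = 0 := by simp [ww_0]
  have cv : eval 1 (cc (n+2)) = (n:ℚ)/24 * (ww n).eval 1 := by simp [cc]
  rw [z, eval_neg] at w1
  rw [cv] at c1
  generalize eval (1 + -h) (ww (n+2)) = p at *
  generalize eval (1 + -h) (cc (n+2)) = q at *
  generalize eval 1 (ww (n+2)) = p0 at *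
  generalize eval 1 (ww n) = q0 at *
  have w2 : |p - (p0 - h^2/2*q0)| ≤ A / s^3 := by
    have : A * h^3 ≤ A / s^3 := by
      have : A * h^3 = A/s^3/8 := by rw [hh]; field_simp; norm_num
      rw [this]
      have : 0 ≤ A / s^3 := by positivity
      linarith
    refine le_trans (le_of_eq ?_) (w1.trans this)
    congr 1; ring
  have c2 : |(q - n/24*q0)/s^2| ≤ B / s^3 := by
    rw [abs_div, abs_of_pos (by positivity : 0 < s^2)]
    calc _ ≤ B * h / s^2 := by gcongr
      _ = B/s^3/2 := by rw [hh]; field_simp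
      _ ≤ _ := by
        have : 0 ≤ B / s^3 := by positivity
        linarith
  have k2 : |s^(n+2) * ((p - (p0 - h^2/2*q0)) + (q - n/24*q0)/s^2)| ≤ (A+B) * (s^(n+2)/s^3) := by
    rw [abs_mul, abs_of_pos (by positivity : 0 < s^(n+2))]
    calc _ ≤ s^(n+2) * (A/s^3 + B/s^3) := by
          gcongr
          exact (abs_add_le _ _).trans (add_le_add w2 c2)
      _ = _ := by ring
  have e : (WW t (n+2) t : ℚ) - (s^(n+2) * p0 + s^n * (((n:ℚ)-3)/24 * q0)) =
      ((WW t (n+2) t : ℚ) - s^(n+2) * (p + q/s^2)) + s^(n+2) * ((p - (p0 - h^2/2*q0)) + (q - n/24*q0)/s^2) := by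
    rw [hh, pow_add]; field_simp; ring
  rw [e]
  refine (abs_add_le _ _).trans ?_
  linarith

def GG (t n k : ℕ) (g : Fin n → Fin t) : Prop :=
  (∀ j : ℕ, (h : j + 1 < n) → (g ⟨j, Nat.lt_of_succ_lt h⟩ : ℕ) + (g ⟨j+1, h⟩ : ℕ) < t) ∧
  ∀ h : 0 < n, (g ⟨0, h⟩ : ℕ) < k

theorem GG_cons (t n k : ℕ) (a : Fin t) (g : Fin n → Fin t) :
    GG t (n+1) k (Fin.cons a g) ↔ (a:ℕ) < k ∧ GG t n (t - a) g := by
  unfold GG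
  constructor
  · rintro ⟨h1, h2⟩
    refine ⟨by simpa using h2 (by omega), fun j h => ?_, fun h => ?_⟩
    · have := h1 (j+1) (by omega)
      exact this
    · have := h1 0 (by omega)
      have h3 : (a:ℕ) + (g ⟨0, h⟩ : ℕ) < t := this
      omega
  · rintro ⟨h0, h1, h2⟩
    refine ⟨fun j h => ?_, fun h => h0⟩
    rcases j with _ | j
    · have := h2 (by omega)
      have h3 : (a:ℕ) + (g ⟨0, by omega⟩ : ℕ) < t := by omega
      exact h3
    · exact h1 j (by omega)

theorem GG_card (t n k : ℕ) (hk : k ≤ t) : Nat.card {g : Fin n → Fin t // GG t n k g} = WW t n k := by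
  induction n generalizing k with
  | zero =>
    rw [WW, Nat.card_eq_one_iff_unique]
    refine ⟨⟨fun a b => Subtype.ext (Subsingleton.elim _ _)⟩, ⟨⟨fun i => i.elim0, ?_⟩⟩⟩
    exact ⟨fun j h => absurd h (by omega), fun h => absurd h (by omega)⟩
  | succ n ih =>
    let e : {g : Fin (n+1) → Fin t // GG t (n+1) k g} ≃ Σ a : Fin k, {g : Fin n → Fin t // GG t n (t - a) g} :=
      { toFun := fun g => ⟨⟨g.1 0, g.2.2 (by omega)⟩, ⟨Fin.tail g.1, by
          have := g.2
          rw [← Fin.cons_self_tail g.1, GG_cons] at this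
          exact this.2⟩⟩
        invFun := fun p => ⟨Fin.cons ⟨p.1, by omega⟩ p.2.1, by
          rw [GG_cons]; exact ⟨p.1.2, p.2.2⟩⟩
        left_inv := fun g => by
          apply Subtype.ext
          exact Fin.cons_self_tail g.1
        right_inv := fun p => by
          rcases p with ⟨a, g, hg⟩
          rfl }
    rw [Nat.card_congr e, Nat.card_sigma, WW, Finset.sum_range]
    exact Finset.sum_congr rfl fun a _ => ih _ (by omega)

theorem zz_card (t n : ℕ) : Nat.card {f : Fin n → Fin t // ZigzagMono n t f} = WW t n t := by
  rw [← GG_card t n t le_rfl]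
  let r : (i : Fin n) → Fin t ≃ Fin t := fun i => if Even (i:ℕ) then Fin.revPerm else Equiv.refl _
  refine Nat.card_congr ((Equiv.piCongrRight r).subtypeEquiv fun f => ?_)
  unfold ZigzagMono GG
  constructor
  · intro H
    refine ⟨fun j h => ?_, fun h => Fin.is_lt _⟩
    have := H j h
    by_cases hj : Even j
    · have h2 : ¬ Odd j := by simpa using hj
      have h3 : ¬ Even (j+1) := by simpa [Nat.even_add_one] using hj
      simp only [h2, if_false, Fin.le_def] at this
      simp [r, hj, h3, Pi.map, Fin.val_rev]
      omega
    · have h2 : Odd j := by simpa using hj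
      have h3 : Even (j+1) := by simpa [Nat.even_add_one] using hj
      simp only [h2, if_true, Fin.le_def] at this
      simp [r, hj, h3, Pi.map, Fin.val_rev]
      omega
  · rintro ⟨H, _⟩ j h
    have := H j h
    by_cases hj : Even j
    · have h2 : ¬ Odd j := by simpa using hj
      have h3 : ¬ Even (j+1) := by simpa [Nat.even_add_one] using hj
      simp only [h2, if_false, Fin.le_def]
      simp [r, hj, h3, Pi.map, Fin.val_rev] at this
      omega
    · have h2 : Odd j := by simpa using hj
      have h3 : Even (j+1) := by simpa [Nat.even_add_one] using hj
      simp only [h2, if_true, Fin.le_def]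
      simp [r, hj, h3, Pi.map, Fin.val_rev] at this
      omega

def Alt {α : Type*} [LT α] (k : ℕ) (σ : Fin k → α) : Prop := ∀ i : ℕ, (h : i + 1 < k) →
    if Even i then σ ⟨i + 1, h⟩ < σ ⟨i, Nat.lt_of_succ_lt h⟩
    else σ ⟨i, Nat.lt_of_succ_lt h⟩ < σ ⟨i + 1, h⟩

theorem alt_comp {n t : ℕ} (e : Fin n ↪o Fin t) (σ : Fin n → Fin n) : Alt n (e ∘ σ) ↔ Alt n σ := by
  unfold Alt; simp

theorem alt_iff {n t : ℕ} (f : Fin n → Fin t) (hf : Function.Injective f) : ZigzagMono n t f ↔ Alt n f := by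
  unfold ZigzagMono Alt
  refine forall_congr' fun j => forall_congr' fun h => ?_
  have hne : f ⟨j, Nat.lt_of_succ_lt h⟩ ≠ f ⟨j+1, h⟩ := fun h' => by
    have := hf h'; simp at this
  by_cases hj : Even j
  · have h2 : ¬ Odd j := by simpa using hj
    simp only [h2, hj, if_true, if_false]
    exact ⟨fun h => lt_of_le_of_ne h hne.symm, le_of_lt⟩
  · have h2 : Odd j := by simpa using hj
    simp only [h2, hj, if_true, if_false]
    exact ⟨fun h => lt_of_le_of_ne h hne, le_of_lt⟩

/-- injective maps factor -/
noncomputable def facEquiv (n t : ℕ) : (Fin n ↪o Fin t) × Equiv.Perm (Fin n) ≃ (Fin n ↪ Fin t) :=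
  Equiv.ofBijective (fun p => p.2.toEmbedding.trans p.1.toEmbedding) <| by
    constructor
    · rintro ⟨e, σ⟩ ⟨e', σ'⟩ h
      have h' : ∀ i, e (σ i) = e' (σ' i) := fun i => DFunLike.congr_fun h i
      have he : e = e' := by
        rw [← OrderEmbedding.range_inj]
        ext x
        constructor
        · rintro ⟨i, rfl⟩
          exact ⟨σ' (σ.symm i), by rw [← h']; simp⟩
        · rintro ⟨i, rfl⟩
          exact ⟨σ (σ'.symm i), by rw [h']; simp⟩
      subst he
      simp only [Prod.mk.injEq, true_and]
      ext i
      exact congrArg _ (e.injective (h' i))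
    · intro f
      have hm : StrictMono (f ∘ Tuple.sort f) :=
        (Tuple.monotone_sort f).strictMono_of_injective (f.injective.comp (Equiv.injective _))
      refine ⟨⟨OrderEmbedding.ofStrictMono _ hm, (Tuple.sort f).symm⟩, ?_⟩
      ext i
      simp

theorem inj_card (n t : ℕ) :
    Nat.card {f : Fin n ↪ Fin t // ZigzagMono n t f} * n.factorial = EulerNumber n * t.descFactorial n := by
  have h1 : Nat.card (Fin n ↪o Fin t) * n.factorial = t.descFactorial n := by
    have := Nat.card_congr (facEquiv n t)
    rw [Nat.card_prod, Nat.card_perm, Nat.card_eq_fintype_card (α := Fin n ↪ Fin t), Fintype.card_embedding_eq] at this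
    simpa using this
  have h2 : Nat.card {f : Fin n ↪ Fin t // ZigzagMono n t f} = Nat.card (Fin n ↪o Fin t) * EulerNumber n := by
    have e1 : {p : (Fin n ↪o Fin t) × Equiv.Perm (Fin n) // Alt n p.2} ≃ {f : Fin n ↪ Fin t // ZigzagMono n t f} :=
      (facEquiv n t).subtypeEquiv fun p => by
        rw [alt_iff _ (Function.Embedding.injective _), ← alt_comp p.1]; rfl
    have e2 : {p : (Fin n ↪o Fin t) × Equiv.Perm (Fin n) // Alt n p.2} ≃ (Fin n ↪o Fin t) × {σ : Equiv.Perm (Fin n) // Alt n σ} :=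
      { toFun := fun p => (p.1.1, ⟨p.1.2, p.2⟩)
        invFun := fun p => ⟨(p.1, p.2.1), p.2.2⟩
        left_inv := fun p => rfl
        right_inv := fun p => rfl }
    rw [← Nat.card_congr e1, Nat.card_congr e2, Nat.card_prod]
    rfl
  rw [h2, ← h1]; ring

theorem zz_lower (n t : ℕ) : Nat.card {f : Fin n ↪ Fin t // ZigzagMono n t f} ≤ WW t n t := by
  rw [← zz_card]
  refine Nat.card_le_card_of_injective (fun f => ⟨f.1, f.2⟩) ?_
  intro f g h
  apply Subtype.ext
  apply DFunLike.coe_injective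
  simpa using h

theorem zz_upper (n t : ℕ) : WW t n t + t.descFactorial n ≤ Nat.card {f : Fin n ↪ Fin t // ZigzagMono n t f} + t^n := by
  classical
  rw [← zz_card]
  have h3 : t^n = Nat.card (Fin n → Fin t) := by simp
  have h4 : t.descFactorial n = Nat.card (Fin n ↪ Fin t) := by
    rw [Nat.card_eq_fintype_card, Fintype.card_embedding_eq]; simp
  rw [h3, h4, ← Nat.card_sum, ← Nat.card_sum]
  let F : {f : Fin n → Fin t // ZigzagMono n t f} ⊕ (Fin n ↪ Fin t) → {f : Fin n ↪ Fin t // ZigzagMono n t f} ⊕ (Fin n → Fin t)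
    | .inl f => if h : Function.Injective f.1 then .inl ⟨⟨f.1, h⟩, f.2⟩ else .inr f.1
    | .inr f => .inr f
  refine Nat.card_le_card_of_injective F ?_
  rintro (⟨f, hf⟩ | f) (⟨g, hg⟩ | g) h
  · by_cases h1 : Function.Injective f <;> by_cases h2 : Function.Injective g <;> simp [F, h1, h2] at h <;> simp [h]
  · by_cases h1 : Function.Injective f <;> simp [F, h1] at h
    exact absurd (h ▸ g.injective) h1
  · by_cases h1 : Function.Injective g <;> simp [F, h1] at h
    exact absurd (h ▸ f.injective) h1
  · simpa [F] using h

open Filter Topology in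
theorem euler_eq (n : ℕ) : (ww n).eval 1 = (EulerNumber n : ℚ) / n.factorial := by
  obtain ⟨K, hK, H⟩ := WW_bound n
  obtain ⟨A, hA, hw⟩ := taylor1 (ww n)
  obtain ⟨B, hB, hc⟩ := bdd (cc n)
  have h1 : ∀ t : ℕ, 0 < t → |(WW t n t : ℚ) / ((t:ℚ)+1/2)^n - (ww n).eval 1| ≤ (K + A + B) / t := by
    intro t ht
    have H := H t t ht le_rfl _ rfl
    have ht1 : (1:ℚ) ≤ t := by exact_mod_cast ht
    set s : ℚ := (t:ℚ) + 1/2 with hs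
    have hs1 : 1 ≤ s := by rw [hs]; linarith
    have hs0 : 0 < s := by linarith
    have hts : (t:ℚ) ≤ s := by rw [hs]; linarith
    have e1 : (t:ℚ)/s = 1 + -(1/(2*s)) := by field_simp; rw [hs]; ring
    have hh1 : |(-(1/(2*s)))| ≤ 1/s := by
      rw [abs_neg, abs_of_pos (by positivity)]
      gcongr; linarith
    have hs2 : 1/s ≤ 1 := by rw [div_le_one hs0]; exact hs1
    have w1 := hw 1 (-(1/(2*s))) (by simp) (hh1.trans hs2)
    rw [← e1] at w1
    have c1 := hc (t/s) (by rw [abs_of_nonneg (by positivity), div_le_one hs0]; exact hts)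
    generalize eval (t/s) (ww n) = p at *
    generalize eval (t/s) (cc n) = q at *
    have a1 : |p - (ww n).eval 1| ≤ A / s := w1.trans (by
      calc _ ≤ A * (1/s) := by gcongr
        _ = _ := by ring)
    have a2 : |q/s^2| ≤ B / s := by
      rw [abs_div, abs_of_pos (by positivity : 0 < s^2)]
      gcongr
      nlinarith
    have a3 : |(WW t n t : ℚ)/s^n - (p + q/s^2)| ≤ K / s := by
      have e : (WW t n t : ℚ)/s^n - (p + q/s^2) = ((WW t n t : ℚ) - s^n * (p + q/s^2)) / s^n := by
        field_simp
      rw [e, abs_div, abs_of_pos (by positivity : 0 < s^n), div_le_iff₀ (by positivity)]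
      refine H.trans ?_
      have : K / s * s^n = K * (s^n / s) := by ring
      rw [this]
      gcongr
      nlinarith [mul_pos hs0 hs0]
    have a4 : |(WW t n t : ℚ)/s^n - (ww n).eval 1| ≤ (K+A+B)/s := by
      rw [add_div, add_div]
      rw [abs_le] at *
      constructor <;> linarith
    refine a4.trans ?_
    gcongr
  have hd : Tendsto (fun t : ℕ => (t.descFactorial n : ℝ) / (t:ℝ)^n) atTop (𝓝 1) := by
    have := isEquivalent_descFactorial n
    rw [Asymptotics.isEquivalent_iff_tendsto_one] at this
    · exact this
    · filter_upwards [eventually_gt_atTop 0] with t ht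
      positivity
  have hf : (0:ℝ) < n.factorial := by exact_mod_cast n.factorial_pos
  have l1 : Tendsto (fun t : ℕ => (WW t n t : ℝ) / (t:ℝ)^n) atTop (𝓝 ((EulerNumber n : ℝ)/n.factorial)) := by
    have lo : Tendsto (fun t : ℕ => (EulerNumber n : ℝ)/n.factorial * ((t.descFactorial n : ℝ) / (t:ℝ)^n)) atTop (𝓝 ((EulerNumber n : ℝ)/n.factorial)) := by
      simpa using hd.const_mul ((EulerNumber n : ℝ)/n.factorial)
    have hi : Tendsto (fun t : ℕ => (EulerNumber n : ℝ)/n.factorial * ((t.descFactorial n : ℝ) / (t:ℝ)^n) + (1 - (t.descFactorial n : ℝ) / (t:ℝ)^n)) atTop (𝓝 ((EulerNumber n : ℝ)/n.factorial)) := by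
      simpa using lo.add (hd.const_sub 1)
    have key : ∀ t : ℕ, (Nat.card {f : Fin n ↪ Fin t // ZigzagMono n t f} : ℝ) = (EulerNumber n : ℝ)/n.factorial * t.descFactorial n := by
      intro t
      have := inj_card n t
      have : (Nat.card {f : Fin n ↪ Fin t // ZigzagMono n t f} : ℝ) * n.factorial = EulerNumber n * t.descFactorial n := by
        exact_mod_cast this
      field_simp
      exact this
    refine tendsto_of_tendsto_of_tendsto_of_le_of_le' lo hi ?_ ?_
    · filter_upwards [eventually_gt_atTop 0] with t ht
      rw [← mul_div_assoc, ← key]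
      gcongr
      exact zz_lower n t
    · filter_upwards [eventually_gt_atTop 0] with t ht
      have htn : (0:ℝ) < (t:ℝ)^n := by positivity
      have := zz_upper n t
      have : (WW t n t : ℝ) + t.descFactorial n ≤ Nat.card {f : Fin n ↪ Fin t // ZigzagMono n t f} + (t:ℝ)^n := by
        exact_mod_cast this
      rw [← mul_div_assoc, ← key, div_le_iff₀ htn]
      have e : ∀ a b : ℝ, (a / (t:ℝ)^n + (1 - b/(t:ℝ)^n)) * (t:ℝ)^n = a + ((t:ℝ)^n - b) := by
        intro a b; field_simp
      rw [e]; linarith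
  have l2 : Tendsto (fun t : ℕ => (t:ℝ)/((t:ℝ)+1/2)) atTop (𝓝 1) := by
    have : Tendsto (fun t : ℕ => 1 - (1/2) * ((t:ℝ)+1/2)⁻¹) atTop (𝓝 (1 - (1/2) * 0)) :=
      ((tendsto_inv_atTop_zero.comp (tendsto_atTop_add_const_right _ _ tendsto_natCast_atTop_atTop)).const_mul _).const_sub _
    rw [mul_zero, sub_zero] at this
    refine this.congr fun t => ?_
    have : (t:ℝ) + 1/2 ≠ 0 := by positivity
    field_simp; ring
  have l3 : Tendsto (fun t : ℕ => (WW t n t : ℝ) / ((t:ℝ)+1/2)^n) atTop (𝓝 ((EulerNumber n : ℝ)/n.factorial)) := by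
    have := l1.mul (l2.pow n)
    rw [one_pow, mul_one] at this
    refine this.congr' ?_
    filter_upwards [eventually_gt_atTop 0] with t ht
    have : (0:ℝ) < t := by exact_mod_cast ht
    rw [div_pow]; field_simp
  have l4 : Tendsto (fun t : ℕ => (WW t n t : ℝ) / ((t:ℝ)+1/2)^n) atTop (𝓝 (((ww n).eval 1 : ℚ) : ℝ)) := by
    rw [tendsto_iff_norm_sub_tendsto_zero]
    refine squeeze_zero' (g := fun t : ℕ => (((K+A+B : ℚ)):ℝ) / (t:ℝ)) (Eventually.of_forall fun t => norm_nonneg _) ?_ (tendsto_const_div_atTop_nhds_zero_nat _)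
    filter_upwards [eventually_gt_atTop 0] with t ht
    have := h1 t ht
    rw [Real.norm_eq_abs]
    have := (Rat.cast_le (K := ℝ)).2 this
    push_cast at this ⊢
    exact this
  have := tendsto_nhds_unique l4 l3
  apply (Rat.cast_injective (α := ℝ))
  rw [this]
  push_cast
  rfl

open Filter Topology in
theorem coeff_zero_of_bound (Q : ℚ[X]) (m : ℕ) (K : ℚ)
    (H : ∀ t : ℕ, 0 < t → |Q.eval ((t:ℚ)+1/2)| ≤ K * (((t:ℚ)+1/2)^m / ((t:ℚ)+1/2))) : Q.coeff m = 0 := by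
  by_contra hne
  have hdeg : (X^m : ℚ[X]).degree ≤ Q.degree := by
    rw [degree_X_pow]; exact le_degree_of_ne_zero hne
  have hO := isBigO_atTop_of_degree_le _ _ hdeg
  have hs : Tendsto (fun t : ℕ => (t:ℚ) + 1/2) atTop atTop :=
    tendsto_atTop_add_const_right _ _ tendsto_natCast_atTop_atTop
  obtain ⟨c, hc, hO⟩ := (hO.comp_tendsto hs).exists_pos
  have h3 := hO.bound
  have h4 : ∀ᶠ t : ℕ in atTop, c * K < (t:ℝ) := tendsto_natCast_atTop_atTop.eventually_gt_atTop _
  obtain ⟨t, h3, h4, h5⟩ := (h3.and (h4.and (eventually_gt_atTop 0))).exists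
  have H := H t h5
  simp only [Function.comp, eval_pow, eval_X] at h3
  set s : ℚ := (t:ℚ) + 1/2 with hs'
  have hs0 : 0 < s := by positivity
  have hts : (t:ℝ) ≤ (s:ℝ) := by rw [hs']; push_cast; linarith
  have hsr : (0:ℝ) < s := by exact_mod_cast hs0
  have n1 : ‖s^m‖ = (s:ℝ)^m := by
    rw [← Rat.norm_cast_real, Real.norm_eq_abs, abs_of_pos (by push_cast; positivity)]; push_cast; rfl
  have n2 : ‖eval s Q‖ ≤ K * ((s:ℝ)^m/s) := by
    rw [← Rat.norm_cast_real, Real.norm_eq_abs]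
    exact_mod_cast H
  rw [n1] at h3
  have : (s:ℝ)^m ≤ c * (K * ((s:ℝ)^m/s)) := h3.trans (by gcongr)
  have e : c * (K * ((s:ℝ)^m/s)) = (s:ℝ)^m * (c*K/s) := by ring
  have lt1 : c*K/s < 1 := by rw [div_lt_one hsr]; linarith
  have : (s:ℝ)^m * (c*K/s) < (s:ℝ)^m * 1 := by gcongr
  linarith

/-- for `n ≥ 2`, the coefficient of `t^{n−2}` in `Ω(Z_n; t − 1/2)`
equals `(n − 5)·E_{n−2}/(24·(n−2)!)`. -/
theorem zigzag_shifted_coeff_sub_two (Ω : ℕ → Polynomial ℚ)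
    (hΩ : ∀ m t : ℕ, 0 < t →
      (Ω m).eval (t : ℚ) = (Nat.card {f : Fin m → Fin t // ZigzagMono m t f} : ℚ))
    (n : ℕ) (hn : 2 ≤ n) :
    ((Ω n).comp (X - C (1 / 2))).coeff (n - 2) =
      ((n : ℚ) - 5) * (EulerNumber (n - 2) : ℚ) / (24 * ((n - 2).factorial : ℚ)) := by
  obtain ⟨m, rfl⟩ : ∃ m, n = m + 2 := ⟨n - 2, by omega⟩
  obtain ⟨K, hK, H⟩ := WW_asymp m
  have hc := coeff_zero_of_bound ((Ω (m+2)).comp (X - C (1/2)) - (C ((ww (m+2)).eval 1) * X^(m+2)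
      + C (((m:ℚ)-3)/24 * (ww m).eval 1) * X^m)) m K (by
    intro t ht
    have H := H t ht _ rfl
    have e := hΩ (m+2) t ht
    rw [zz_card] at e
    have hs : (0:ℚ) < (t:ℚ) + 1/2 := by positivity
    have e2 : ((t:ℚ)+1/2)^(m+2) / ((t:ℚ)+1/2)^3 = ((t:ℚ)+1/2)^m / ((t:ℚ)+1/2) := by
      rw [pow_add]; field_simp
    rw [e2] at H
    refine le_trans (le_of_eq ?_) H
    simp only [eval_sub, eval_comp, eval_add, eval_mul, eval_C, eval_pow, eval_X, add_sub_cancel_right, e]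
    congr 1; ring)
  rw [coeff_sub, sub_eq_zero] at hc
  rw [Nat.add_sub_cancel, hc, coeff_add, coeff_C_mul, coeff_C_mul, coeff_X_pow, coeff_X_pow, euler_eq m]
  simp
  field_simp
  ring
end

section
/- For every integer n ≥ 2 and every real number t, Ω(Z_n; t − 1/2) = Σ_{k=0}^{n} (E_k / k!) · γ_{n,k} · t^k, where γ_{n,k} denotes the coefficient of x^k z^n in the Taylor expansion at (0,0) of the real-analytic function G(z,x) = sqrt(1 − z²/4) · (1 + 2x·arcsin(z/2)) / (1 − 4x²·arcsin(z/2)²), i.e. γ_{n,k} = (1/(n!·k!)) · ∂_z^n ∂_x^k G(0,0). -/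
/-- `G(z,x) = sqrt(1 − z²/4)·(1 + 2x·arcsin(z/2)) / (1 − 4x²·arcsin(z/2)²)`. -/
noncomputable def Gfun (z x : ℝ) : ℝ :=
  Real.sqrt (1 - z ^ 2 / 4) * (1 + 2 * x * Real.arcsin (z / 2)) /
    (1 - 4 * x ^ 2 * Real.arcsin (z / 2) ^ 2)

/-- `γ_{n,k} = (1/(n!·k!))·∂_z^n ∂_x^k G(0,0)`, the Taylor coefficient of
`x^k z^n` of `G` at `(0,0)`. -/
noncomputable def gammaCoef (n k : ℕ) : ℝ :=
  (1 / ((n.factorial : ℝ) * (k.factorial : ℝ))) *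
    iteratedDeriv n (fun z => iteratedDeriv k (fun x => Gfun z x) 0) 0

noncomputable def zzTc (n : ℕ) (f : ℝ → ℝ) : ℝ := iteratedDeriv n f 0 / (n.factorial : ℝ)

lemma zzTc_congr {f g : ℝ → ℝ} (n : ℕ) (h : f =ᶠ[nhds 0] g) : zzTc n f = zzTc n g := by
  unfold zzTc; rw [h.iteratedDeriv_eq]

lemma zzTc_zero (f : ℝ → ℝ) : zzTc 0 f = f 0 := by simp [zzTc]

lemma zzTc_add {f g : ℝ → ℝ} (n : ℕ) (hf : AnalyticAt ℝ f 0) (hg : AnalyticAt ℝ g 0) :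
    zzTc n (fun z => f z + g z) = zzTc n f + zzTc n g := by
  unfold zzTc
  rw [iteratedDeriv_fun_add hf.contDiffAt hg.contDiffAt, add_div]

lemma zzTc_sub {f g : ℝ → ℝ} (n : ℕ) (hf : AnalyticAt ℝ f 0) (hg : AnalyticAt ℝ g 0) :
    zzTc n (fun z => f z - g z) = zzTc n f - zzTc n g := by
  unfold zzTc
  rw [iteratedDeriv_fun_sub hf.contDiffAt hg.contDiffAt, sub_div]

lemma zzTc_const_mul {f : ℝ → ℝ} (n : ℕ) (c : ℝ) :
    zzTc n (fun z => c * f z) = c * zzTc n f := by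
  unfold zzTc
  rw [iteratedDeriv_const_mul_field, mul_div_assoc]

lemma zzTc_sum {ι : Type*} (s : Finset ι) {f : ι → ℝ → ℝ} (n : ℕ)
    (hf : ∀ i ∈ s, AnalyticAt ℝ (f i) 0) :
    zzTc n (fun z => ∑ i ∈ s, f i z) = ∑ i ∈ s, zzTc n (f i) := by
  unfold zzTc
  rw [iteratedDeriv_fun_sum (fun i hi => (hf i hi).contDiffAt), Finset.sum_div]

lemma zzTc_const_succ (n : ℕ) (c : ℝ) : zzTc (n+1) (fun _ => c) = 0 := by
  simp [zzTc, iteratedDeriv_const]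

lemma zzTc_id_mul {f : ℝ → ℝ} (n : ℕ) (hf : AnalyticAt ℝ f 0) :
    zzTc (n+1) (fun z => z * f z) = zzTc n f := by
  unfold zzTc
  rw [iteratedDeriv_fun_mul (f := fun z : ℝ => z) contDiffAt_id hf.contDiffAt]
  rw [Finset.sum_eq_single 1]
  · simp only [iteratedDeriv_fun_id_zero, Nat.factorial_succ, Nat.choose_one_right]
    have : ((n.factorial : ℝ)) ≠ 0 := by positivity
    have : ((n : ℝ) + 1) ≠ 0 := by positivity
    push_cast
    simp
    field_simp
  · intro b _ hb
    simp [iteratedDeriv_fun_id_zero, hb]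
  · simp

lemma zzTc_pow_mul {f : ℝ → ℝ} (n k : ℕ) (hf : AnalyticAt ℝ f 0) :
    zzTc (n+k) (fun z => z ^ k * f z) = zzTc n f := by
  induction k generalizing f with
  | zero => simp
  | succ k ih =>
    have : (fun z : ℝ => z ^ (k+1) * f z) = fun z => z ^ k * (z * f z) := by
      funext z; ring
    rw [this]
    have h := zzTc_id_mul n hf
    have h2 := ih (f := fun z => z * f z) (by fun_prop)
    have h3 : zzTc (n+1+k) (fun z => z ^ k * (z * f z)) = zzTc (n+1) (fun z => z * f z) := by
      clear h2 
      have : ∀ (g : ℝ → ℝ), AnalyticAt ℝ g 0 → ∀ k N, zzTc (N+k) (fun z => z ^ k * g z) = zzTc N g := by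
        intro g hg k
        induction k with
        | zero => simp
        | succ k ih =>
          intro N
          have : (fun z : ℝ => z ^ (k+1) * g z) = fun z => z * (z ^ k * g z) := by
            funext z; ring
          rw [this, ← ih N, ← add_assoc, zzTc_id_mul _ (by fun_prop)]
      exact this _ (by fun_prop) k _
    rw [show n + (k+1) = n + 1 + k by ring, h3, h]

lemma zzTc_pow_mul_lt {f : ℝ → ℝ} (n k : ℕ) (hk : n < k) (hf : AnalyticAt ℝ f 0) :
    zzTc n (fun z => z ^ k * f z) = 0 := by
  obtain ⟨d, rfl⟩ : ∃ d, k = n + (d + 1) := ⟨k - n - 1, by omega⟩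
  have : (fun z : ℝ => z ^ (n + (d+1)) * f z) = fun z => z ^ n * (z ^ (d+1) * f z) := by
    funext z; ring
  rw [this]
  have := zzTc_pow_mul (f := fun z => z ^ (d+1) * f z) 0 n (by fun_prop)
  rw [zero_add] at this
  rw [this, zzTc_zero]; simp

lemma zz_analytic_dslope {f : ℝ → ℝ} (hf : AnalyticAt ℝ f 0) : AnalyticAt ℝ (dslope f 0) 0 := by
  obtain ⟨p, hp⟩ := hf
  exact ⟨_, hp.has_fpower_series_dslope_fslope⟩

lemma zz_dslope_eq (f : ℝ → ℝ) (y : ℝ) : f y = f 0 + y * dslope f 0 y := by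
  have := sub_smul_dslope f 0 y
  simp only [sub_zero, smul_eq_mul] at this
  rw [this]; ring

/-- Taylor expansion with analytic remainder. -/
lemma zz_taylor {f : ℝ → ℝ} (hf : AnalyticAt ℝ f 0) : ∃ a : ℕ → ℝ, ∀ n, ∃ R : ℝ → ℝ,
    AnalyticAt ℝ R 0 ∧ ∀ y, f y = (∑ k ∈ Finset.range n, a k * y ^ k) + y ^ n * R y := by
  let D : ℕ → ℝ → ℝ := fun k => (fun g => dslope g 0)^[k] f
  have hD : ∀ k, D (k+1) = dslope (D k) 0 := fun k => by
    simp only [D, Function.iterate_succ_apply']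
  have hA : ∀ k, AnalyticAt ℝ (D k) 0 := by
    intro k
    induction k with
    | zero => exact hf
    | succ k ih => rw [hD]; exact zz_analytic_dslope ih
  refine ⟨fun k => D k 0, fun n => ⟨D n, hA n, fun y => ?_⟩⟩
  induction n with
  | zero => simp [D]
  | succ n ih =>
    rw [ih, Finset.sum_range_succ, hD, zz_dslope_eq (D n) y]
    ring

noncomputable def zzTh (z : ℝ) : ℝ := Real.arcsin (z / 2)

lemma zzTh_analytic : AnalyticAt ℝ zzTh 0 := by
  have h : AnalyticAt ℝ Real.arcsin ((fun z : ℝ => z / 2) 0) := by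
    apply ContDiffAt.analyticAt
    apply Real.contDiffAt_arcsin <;> norm_num
  exact h.comp (f := fun z : ℝ => z / 2) (by simp only [div_eq_mul_inv]; fun_prop)

lemma zzTh_zero : zzTh 0 = 0 := by simp [zzTh]

lemma zzTh_cos (z : ℝ) : Real.cos (zzTh z) = Real.sqrt (1 - z ^ 2 / 4) := by
  rw [zzTh, Real.cos_arcsin]; congr 1; ring

lemma zzTh_sin : ∀ᶠ z in nhds (0:ℝ), z = 2 * Real.sin (zzTh z) := by
  filter_upwards [Ioo_mem_nhds (show (-1:ℝ) < 0 by norm_num) (show (0:ℝ) < 1 by norm_num)] with z hz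
  rw [zzTh, Real.sin_arcsin] <;> linarith [hz.1, hz.2]

lemma zzTh_factor : ∃ g : ℝ → ℝ, AnalyticAt ℝ g 0 ∧ g 0 = 1 ∧ ∀ z, 2 * zzTh z = z * g z := by
  refine ⟨dslope (fun z => 2 * zzTh z) 0, zz_analytic_dslope ?_, ?_, ?_⟩
  · have := zzTh_analytic
    fun_prop
  · rw [dslope_same]
    have h : HasDerivAt Real.arcsin (1 / √(1 - (0/2:ℝ) ^ 2)) (0/2) :=
      Real.hasDerivAt_arcsin (by norm_num) (by norm_num)
    have h2 := (h.comp (0:ℝ) ((hasDerivAt_id (0:ℝ)).div_const 2)).const_mul 2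
    have h3 := h2.deriv
    simp only [Function.comp_def, id] at h3
    simp only [zzTh]
    rw [h3]; norm_num
  · intro z
    have := zz_dslope_eq (fun z => 2 * zzTh z) z
    simpa [zzTh_zero] using this

/-- the function whose Taylor coefficients are the gammas -/
noncomputable def zzGm (k : ℕ) (z : ℝ) : ℝ := Real.cos (zzTh z) * (2 * zzTh z) ^ k

lemma zzGm_analytic (k : ℕ) : AnalyticAt ℝ (zzGm k) 0 := by
  have := zzTh_analytic
  unfold zzGm
  exact (Real.analyticAt_cos.comp this).mul (by fun_prop)

lemma zz_geom (k : ℕ) (s b : ℝ) : zzTc k (fun x => s * (1 - b * x)⁻¹) = s * b ^ k := by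
  have han : AnalyticAt ℝ (fun x : ℝ => (1 - b * x)⁻¹) 0 := by
    apply AnalyticAt.inv (by fun_prop) (by simp)
  rw [zzTc_const_mul]
  congr 1
  induction k with
  | zero => simp [zzTc_zero]
  | succ k ih =>
    have hne : ∀ᶠ x in nhds (0:ℝ), 1 - b * x ≠ 0 := by
      have : ContinuousAt (fun x : ℝ => 1 - b * x) 0 := by fun_prop
      exact this.eventually_ne (by simp)
    have : (fun x : ℝ => (1 - b * x)⁻¹) =ᶠ[nhds 0] fun x => 1 + b * (x * (1 - b * x)⁻¹) := by
      filter_upwards [hne] with x hx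
      field_simp
      ring
    rw [zzTc_congr _ this, zzTc_add _ (by fun_prop) (by fun_prop), zzTc_const_succ,
      zzTc_const_mul (f := fun x => x * (1 - b * x)⁻¹), zzTc_id_mul _ han, ih]
    ring

lemma zz_gammaCoef (n k : ℕ) : gammaCoef n k = zzTc n (zzGm k) := by
  have h1 : ∀ z, iteratedDeriv k (fun x => Gfun z x) 0 = k.factorial * zzGm k z := by
    intro z
    have h := zz_geom k (Real.cos (zzTh z)) (2 * zzTh z)
    have h2 : (fun x => Gfun z x) =ᶠ[nhds 0]
        (fun x => Real.cos (zzTh z) * (1 - (2 * zzTh z) * x)⁻¹) := by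
      have c1 : ContinuousAt (fun x : ℝ => 1 - (2 * zzTh z) * x) 0 := by fun_prop
      have c2 : ContinuousAt (fun x : ℝ => 1 + (2 * zzTh z) * x) 0 := by fun_prop
      filter_upwards [c1.eventually_ne (y := 0) (by simp), c2.eventually_ne (y := 0) (by simp)]
        with x hx hy
      unfold Gfun
      rw [← zzTh_cos, ← zzTh]
      have : 1 - 4 * x ^ 2 * zzTh z ^ 2 = (1 - (2 * zzTh z) * x) * (1 + (2 * zzTh z) * x) := by ring
      rw [this, show 2 * x * zzTh z = 2 * zzTh z * x by ring, mul_div_mul_right _ _ hy,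
        div_eq_mul_inv]
    rw [h2.iteratedDeriv_eq]
    unfold zzTc at h
    rw [div_eq_iff (by positivity)] at h
    rw [h, zzGm]; ring
  unfold gammaCoef
  simp only [h1]
  rw [iteratedDeriv_const_mul_field, zzTc]
  have : (k.factorial : ℝ) ≠ 0 := by positivity
  field_simp

lemma zz_gamma_diag (n : ℕ) : zzTc n (zzGm n) = 1 := by
  obtain ⟨g, hg, hg0, hgz⟩ := zzTh_factor
  have : zzGm n = fun z => z ^ n * (g z ^ n * Real.cos (zzTh z)) := by
    funext z; rw [zzGm, hgz]; ring
  have hc : AnalyticAt ℝ (fun z => Real.cos (zzTh z)) 0 := Real.analyticAt_cos.comp zzTh_analytic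
  have h := zzTc_pow_mul (f := fun z => (g z ^ n * Real.cos (zzTh z))) 0 n (by fun_prop)
  rw [zero_add] at h
  rw [this, h, zzTc_zero]
  simp [hg0, zzTh_zero]

noncomputable def zzV (m i : ℕ) (z : ℝ) : ℝ :=
  (Real.cos ((2 * m - 2 * i - 1) * zzTh z) + Real.sin ((2 * i + 2) * zzTh z)) /
    Real.cos ((2 * m + 1) * zzTh z)

lemma zz_cos_ne (m : ℕ) : ∀ᶠ z in nhds (0:ℝ), Real.cos ((2 * m + 1) * zzTh z) ≠ 0 := by
  have := zzTh_analytic.continuousAt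
  have c1 : ContinuousAt (fun z : ℝ => Real.cos ((2 * m + 1) * zzTh z)) 0 := by fun_prop
  exact c1.eventually_ne (by simp [zzTh_zero])

lemma zz_cos_an (c : ℝ) : AnalyticAt ℝ (fun z : ℝ => Real.cos (c * zzTh z)) 0 := by
  have := zzTh_analytic
  exact Real.analyticAt_cos.comp (f := fun z => c * zzTh z) (by fun_prop)

lemma zz_sin_an (c : ℝ) : AnalyticAt ℝ (fun z : ℝ => Real.sin (c * zzTh z)) 0 := by
  have := zzTh_analytic
  exact Real.analyticAt_sin.comp (f := fun z => c * zzTh z) (by fun_prop)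

lemma zzV_analytic (m i : ℕ) : AnalyticAt ℝ (zzV m i) 0 := by
  unfold zzV
  refine AnalyticAt.div ((zz_cos_an _).add (zz_sin_an _)) (zz_cos_an _) ?_
  simp [zzTh_zero]

lemma zzV_zero (m : ℕ) (hm : 0 < m) :
    zzV m 0 =ᶠ[nhds 0] fun z => 1 + z * zzV m (m - 1) z := by
  filter_upwards [zz_cos_ne m, zzTh_sin] with z hz hs
  unfold zzV
  push_cast [Nat.cast_sub (show 1 ≤ m from hm)]
  rw [← mul_div_assoc, ← sub_eq_iff_eq_add', ← sub_eq_zero, div_sub_one hz, ← sub_div, div_eq_zero_iff]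
  left
  set θ := zzTh z
  have e1 : Real.cos ((2 * m - 2 * 0 - 1) * θ) = Real.cos (2 * m * θ - θ) := by ring_nf
  have e2 : Real.cos ((2 * m + 1) * θ) = Real.cos (2 * m * θ + θ) := by ring_nf
  have e3 : Real.sin ((2 * (m - 1) + 2) * θ) = Real.sin (2 * m * θ) := by ring_nf
  have e4 : Real.cos ((2 * m - 2 * (m - 1) - 1) * θ) = Real.cos θ := by ring_nf
  have e6 : Real.sin ((2 * 0 + 2) * θ) = Real.sin (2 * θ) := by ring_nf
  rw [e1, e2, e3, e4, e6, Real.cos_sub, Real.cos_add, Real.sin_two_mul]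
  linear_combination (-(Real.cos θ + Real.sin (2 * m * θ))) * hs

lemma zzV_succ (m i : ℕ) (hm : i + 1 < m) :
    zzV m (i+1) =ᶠ[nhds 0] fun z => zzV m i z + z * zzV m (m - 1 - (i + 1)) z := by
  filter_upwards [zz_cos_ne m, zzTh_sin] with z hz hs
  unfold zzV
  rw [Nat.sub_sub]
  push_cast [Nat.cast_sub (show 1 + (i + 1) ≤ m by omega)]
  rw [← mul_div_assoc, ← add_div]
  congr 1
  set θ := zzTh z
  have e1 : Real.cos ((2 * m - 2 * (i+1) - 1) * θ) = Real.cos ((2 * m - 2 * (i+1)) * θ - θ) := by ring_nf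
  have e2 : Real.cos ((2 * m - 2 * i - 1) * θ) = Real.cos ((2 * m - 2 * (i+1)) * θ + θ) := by ring_nf
  have e3 : Real.sin ((2 * (i+1) + 2) * θ) = Real.sin ((2 * i + 3) * θ + θ) := by ring_nf
  have e4 : Real.sin ((2 * i + 2) * θ) = Real.sin ((2 * i + 3) * θ - θ) := by ring_nf
  have e5 : Real.cos ((2 * m - 2 * (m - (1 + (i + 1))) - 1) * θ) = Real.cos ((2 * i + 3) * θ) := by ring_nf
  have e6 : Real.sin ((2 * (m - (1 + (i + 1))) + 2) * θ) = Real.sin ((2 * m - 2 * (i+1)) * θ) := by ring_nf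
  rw [e1, e2, e3, e4, e5, e6, Real.cos_sub, Real.cos_add, Real.sin_sub, Real.sin_add]
  linear_combination (-(Real.sin ((2 * m - 2 * (i+1)) * θ) + Real.cos ((2 * i + 3) * θ))) * hs

lemma zzTc_V_zero (m i : ℕ) : zzTc 0 (zzV m i) = 1 := by
  simp [zzTc_zero, zzV, zzTh_zero]

lemma zzTc_V_succ (m n i : ℕ) (hi : i < m) :
    zzTc (n+1) (zzV m i) = ∑ j ∈ Finset.range (i+1), zzTc n (zzV m (m - 1 - j)) := by
  induction i with
  | zero =>
    have h := zzV_analytic m (m-1)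
    rw [zzTc_congr _ (zzV_zero m hi), zzTc_add _ (by fun_prop) (by fun_prop), zzTc_const_succ,
      zzTc_id_mul _ h]
    simp
  | succ i ih =>
    have h := zzV_analytic m (m-1 - (i+1))
    have h' := zzV_analytic m i
    rw [zzTc_congr _ (zzV_succ m i hi), zzTc_add _ (by fun_prop) (by fun_prop),
      zzTc_id_mul _ h, ih (by omega), Finset.sum_range_succ _ (i+1)]

noncomputable def zzA (y : ℝ) : ℝ := (1 + Real.sin y) / Real.cos y

lemma zzA_analytic : AnalyticAt ℝ zzA 0 := by
  unfold zzA
  refine AnalyticAt.div ?_ Real.analyticAt_cos (by simp)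
  exact analyticAt_const.add Real.analyticAt_sin

lemma zzV_last (m : ℕ) (hm : 0 < m) : zzV m (m - 1) =ᶠ[nhds 0]
    fun z => Real.cos (zzTh z) * zzA ((2 * m + 1) * zzTh z) - z * (1 / 2) := by
  filter_upwards [zz_cos_ne m, zzTh_sin] with z hz hs
  unfold zzV zzA
  push_cast [Nat.cast_sub (show 1 ≤ m from hm)]
  rw [eq_sub_iff_add_eq, ← mul_div_assoc (Real.cos (zzTh z)), div_add' _ _ _ hz]
  congr 1
  set θ := zzTh z
  have e1 : Real.cos ((2 * m - 2 * (m - 1) - 1) * θ) = Real.cos θ := by ring_nf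
  have e2 : Real.sin ((2 * (m - 1) + 2) * θ) = Real.sin ((2 * m + 1) * θ - θ) := by ring_nf
  rw [e1, e2, Real.sin_sub]
  linear_combination (Real.cos ((2 * m + 1) * θ) / 2) * hs

lemma zz_expansion : ∃ a : ℕ → ℝ, ∀ m n : ℕ, 0 < m → zzTc n (zzV m (m - 1)) =
    (∑ k ∈ Finset.range (n+1), a k * zzTc n (zzGm k) * ((m:ℝ) + 1/2) ^ k)
      - if n = 1 then 1/2 else 0 := by
  obtain ⟨a, ha⟩ := zz_taylor zzA_analytic
  refine ⟨a, fun m n hm => ?_⟩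
  obtain ⟨R, hR, hA⟩ := ha (n+1)
  obtain ⟨g, hg, hg0, hgz⟩ := zzTh_factor
  have hth := zzTh_analytic
  have hRc : AnalyticAt ℝ (fun z => R ((2 * m + 1) * zzTh z)) 0 := by
    have : AnalyticAt ℝ R ((fun z => (2 * m + 1) * zzTh z) 0) := by simpa [zzTh_zero] using hR
    exact this.comp (f := fun z => (2 * m + 1) * zzTh z) (by fun_prop)
  have hc : AnalyticAt ℝ (fun z => Real.cos (zzTh z)) 0 := Real.analyticAt_cos.comp zzTh_analytic
  have hbig : AnalyticAt ℝ (fun z => (((m:ℝ) + 1/2) ^ (n+1) * g z ^ (n+1) * Real.cos (zzTh z) *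
          R ((2 * m + 1) * zzTh z))) 0 := by
    refine AnalyticAt.mul ?_ hRc
    fun_prop
  have key : (fun z => Real.cos (zzTh z) * zzA ((2 * m + 1) * zzTh z) - z * (1 / 2)) =
      fun z => ((∑ k ∈ Finset.range (n+1), (a k * ((m:ℝ) + 1/2) ^ k) * zzGm k z) +
        z ^ (n+1) * (((m:ℝ) + 1/2) ^ (n+1) * g z ^ (n+1) * Real.cos (zzTh z) *
          R ((2 * m + 1) * zzTh z))) - z * (1/2) := by
    funext z
    have hz : (2 * m + 1) * zzTh z = ((m:ℝ) + 1/2) * (2 * zzTh z) := by ring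
    rw [hA, mul_add, Finset.mul_sum]
    congr 2
    · apply Finset.sum_congr rfl
      intro k _
      rw [hz, zzGm, mul_pow]; ring
    · have : ((2 * m + 1) * zzTh z) ^ (n+1) = (((m:ℝ) + 1/2) * (z * g z)) ^ (n+1) := by
        rw [hz, hgz]
      rw [this, mul_pow, mul_pow]; ring
  have hG := zzGm_analytic
  rw [zzTc_congr _ (zzV_last m hm), key, zzTc_sub, zzTc_add, zzTc_pow_mul_lt, zzTc_sum]
  · rw [add_zero]
    congr 1
    · apply Finset.sum_congr rfl
      intro k _
      rw [zzTc_const_mul]; ring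
    · rcases n with _ | n
      · simp [zzTc_zero]
      · rw [zzTc_id_mul _ (by fun_prop)]
        rcases n with _ | n
        · simp [zzTc_zero]
        · rw [zzTc_const_succ]; simp
  · intro k _; have := hG k; fun_prop
  · omega
  · exact hbig
  · apply Finset.analyticAt_fun_sum
    intro k _; have := hG k; fun_prop
  · exact AnalyticAt.mul (by fun_prop) hbig
  · refine AnalyticAt.add ?_ (AnalyticAt.mul (by fun_prop) hbig)
    apply Finset.analyticAt_fun_sum
    intro k _; have := hG k; fun_prop
  · fun_prop

noncomputable def zzD (n m : ℕ) (i : Fin m) : ℕ :=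
  Nat.card {g : Fin (n+1) → Fin m // ZigzagMono (n+1) m g ∧ g 0 = i}

lemma zz_cons_iff (n m : ℕ) (i : Fin m) (f : Fin n → Fin m) :
    ZigzagMono (n+1) m (Fin.cons i (fun k => Fin.rev (f k)) : Fin (n+1) → Fin m) ↔
      ZigzagMono n m f ∧ ∀ h : 0 < n, Fin.rev (f ⟨0, h⟩) ≤ i := by
  have hs : ∀ (j : ℕ) (h : j + 1 < n + 1),
      (Fin.cons i (fun k => Fin.rev (f k)) : Fin (n+1) → Fin m) ⟨j+1, h⟩
        = Fin.rev (f ⟨j, by omega⟩) := by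
    intro j h
    exact Fin.cons_succ (α := fun _ => Fin m) i (fun k => Fin.rev (f k)) ⟨j, by omega⟩
  have h0 : (Fin.cons i (fun k => Fin.rev (f k)) : Fin (n+1) → Fin m) ⟨0, by omega⟩ = i := rfl
  constructor
  · intro H
    refine ⟨fun j h => ?_, fun h => ?_⟩
    · have := H (j+1) (by omega)
      rw [hs, hs] at this
      by_cases hj : Odd j
      · have hj' : ¬ Odd (j+1) := by rw [Nat.odd_add_one]; simpa using hj
        simpa [hj, hj', Fin.rev_le_rev] using this
      · have hj' : Odd (j+1) := by rw [Nat.odd_add_one]; exact hj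
        simpa [hj, hj', Fin.rev_le_rev] using this
    · have := H 0 (by omega)
      rw [hs, h0] at this
      simpa using this
  · rintro ⟨H, H0⟩ j h
    rw [hs]
    rcases j with _ | j
    · rw [h0]; simpa using H0 (by omega)
    · rw [hs]
      have := H j (by omega)
      by_cases hj : Odd j
      · have hj' : ¬ Odd (j+1) := by rw [Nat.odd_add_one]; simpa using hj
        simpa [hj, hj', Fin.rev_le_rev] using this
      · have hj' : Odd (j+1) := by rw [Nat.odd_add_one]; exact hj
        simpa [hj, hj', Fin.rev_le_rev] using this

lemma zzD_eq (n m : ℕ) (i : Fin m) : zzD n m i =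
    Nat.card {f : Fin n → Fin m // ZigzagMono n m f ∧ ∀ h : 0 < n, Fin.rev (f ⟨0, h⟩) ≤ i} := by
  symm
  refine Nat.card_congr (Equiv.ofBijective (fun f =>
    ⟨Fin.cons i (fun k => Fin.rev (f.1 k)), (zz_cons_iff n m i f.1).2 f.2, rfl⟩) ⟨?_, ?_⟩)
  · rintro ⟨f, hf⟩ ⟨g, hg⟩ h
    have h1 := congrArg Subtype.val h
    simp only at h1
    have h2 := (Fin.cons_injective2 h1).2
    apply Subtype.ext
    funext k
    exact Fin.rev_injective (congrFun h2 k)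
  · rintro ⟨g, hg, hg0⟩
    have e : (Fin.cons i (fun k => Fin.rev ((fun k : Fin n => Fin.rev (g k.succ)) k))
        : Fin (n+1) → Fin m) = g := by
      funext k
      refine Fin.cases ?_ (fun k => ?_) k
      · simp [hg0]
      · simp
    refine ⟨⟨fun k => Fin.rev (g k.succ), ?_⟩, Subtype.ext e⟩
    rw [← zz_cons_iff n m i, e]
    exact hg

lemma zzN_eq (n m : ℕ) (hm : 0 < m) :
    Nat.card {f : Fin n → Fin m // ZigzagMono n m f} = zzD n m ⟨m - 1, by omega⟩ := by
  rw [zzD_eq]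
  refine Nat.card_congr (Equiv.subtypeEquivRight fun f => ?_)
  constructor
  · intro h
    refine ⟨h, fun _ => ?_⟩
    rw [Fin.le_def]
    have := (Fin.rev (f ⟨0, by assumption⟩)).2
    simp only
    omega
  · exact fun h => h.1

lemma zzD_zero (m : ℕ) (i : Fin m) : zzD 0 m i = 1 := by
  rw [zzD_eq, Nat.card_eq_one_iff_unique]
  refine ⟨⟨fun a b => Subtype.ext (Subsingleton.elim _ _)⟩, ⟨⟨Fin.elim0, ?_, ?_⟩⟩⟩
  · intro j h; omega
  · intro h; omega

lemma zzD_succ (n m : ℕ) (i : Fin m) :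
    zzD (n+1) m i = ∑ j ∈ Finset.univ.filter (fun j : Fin m => Fin.rev j ≤ i), zzD n m j := by
  classical
  rw [zzD_eq, Nat.card_eq_fintype_card, Fintype.card_subtype]
  rw [Finset.card_eq_sum_card_fiberwise (f := fun f : Fin (n+1) → Fin m => f 0)
    (t := Finset.univ.filter (fun j : Fin m => Fin.rev j ≤ i))]
  · apply Finset.sum_congr rfl
    intro j hj
    rw [zzD, Nat.card_eq_fintype_card, Fintype.card_subtype, Finset.filter_filter]
    congr 1
    ext f
    simp only [Finset.mem_filter, Finset.mem_univ, true_and] at hj ⊢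
    constructor
    · rintro ⟨⟨h1, _⟩, h3⟩; exact ⟨h1, h3⟩
    · rintro ⟨h1, h3⟩; exact ⟨⟨h1, fun _ => by rw [← h3] at hj; exact hj⟩, h3⟩
  · intro f hf
    simp only [Finset.coe_filter, Finset.mem_univ, true_and, Set.mem_ofPred_eq] at hf ⊢
    exact hf.2 (by omega)

lemma zzD_tc (n m : ℕ) (i : Fin m) : (zzD n m i : ℝ) = zzTc n (zzV m i) := by
  induction n generalizing i with
  | zero => rw [zzD_zero, zzTc_V_zero]; simp
  | succ n ih =>
    rw [zzD_succ, zzTc_V_succ _ _ _ i.2]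
    push_cast
    symm
    refine Finset.sum_bij (fun (j : ℕ) hj =>
      (⟨m - 1 - j, by have := i.2; omega⟩ : Fin m)) ?_ ?_ ?_ ?_
    · intro j hj
      have hi := i.2
      simp only [Finset.mem_range] at hj
      simp only [Finset.mem_filter, Finset.mem_univ, true_and, Fin.le_def, Fin.val_rev]
      omega
    · intro a ha b hb h
      have hi := i.2
      simp only [Finset.mem_range, Fin.mk.injEq] at ha hb h
      omega
    · intro b hb
      have hi := i.2
      have hb' := b.2
      simp only [Finset.mem_filter, Finset.mem_univ, true_and, Fin.le_def, Fin.val_rev] at hb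
      refine ⟨m - 1 - b, by simp only [Finset.mem_range]; omega, ?_⟩
      apply Fin.ext; simp only; omega
    · intro j hj
      rw [ih]

noncomputable def zzN (n m : ℕ) : ℕ := Nat.card {f : Fin n → Fin m // ZigzagMono n m f}

lemma zz_count : ∃ a : ℕ → ℝ, ∀ m n : ℕ, 0 < m → (zzN n m : ℝ) =
    (∑ k ∈ Finset.range (n+1), a k * zzTc n (zzGm k) * ((m:ℝ) + 1/2) ^ k)
      - if n = 1 then 1/2 else 0 := by
  obtain ⟨a, ha⟩ := zz_expansion
  refine ⟨a, fun m n hm => ?_⟩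
  rw [← ha m n hm, zzN, zzN_eq n m hm, zzD_tc]

lemma zz_inj_count (n m : ℕ) :
    Nat.card {f : Fin n → Fin m // ZigzagMono n m f ∧ Function.Injective f} =
      EulerNumber n * m.choose n := by
  classical
  have hc : m.choose n = Nat.card {s : Finset (Fin m) // s.card = n} := by
    rw [Nat.card_eq_fintype_card, Fintype.card_finset_len, Fintype.card_fin]
  rw [hc, EulerNumber, ← Nat.card_prod]
  symm
  refine Nat.card_congr (Equiv.ofBijective (fun p =>
    ⟨fun k => p.2.1.orderEmbOfFin p.2.2 (p.1.1 k), ?_, ?_⟩) ⟨?_, ?_⟩)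
  · intro j h
    have := p.1.2 j h
    by_cases hj : Odd j
    · have hj' : ¬ Even j := by simpa using hj
      rw [if_neg hj'] at this
      rw [if_pos hj]
      exact (OrderEmbedding.monotone _) this.le
    · have hj' : Even j := by simpa using hj
      rw [if_pos hj'] at this
      rw [if_neg hj]
      exact (OrderEmbedding.monotone _) this.le
  · exact (p.2.1.orderEmbOfFin p.2.2).injective.comp p.1.1.injective
  · rintro ⟨⟨σ, hσ⟩, ⟨s, hs⟩⟩ ⟨⟨τ, hτ⟩, ⟨u, hu⟩⟩ h
    have h1 := congrArg Subtype.val h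
    simp only at h1
    have hr : ∀ (s : Finset (Fin m)) (hs : s.card = n) (σ : Equiv.Perm (Fin n)),
        Set.range (fun k => s.orderEmbOfFin hs (σ k)) = s := by
      intro s hs σ
      rw [← Finset.range_orderEmbOfFin s hs]
      exact σ.surjective.range_comp _
    have hsu : s = u := by
      have := congrArg Set.range h1
      rw [hr, hr] at this
      exact_mod_cast this
    subst hsu
    have : σ = τ := by
      ext k
      have := (s.orderEmbOfFin hs).injective (congrFun h1 k)
      rw [this]
    subst this
    rfl
  · rintro ⟨f, hf, hinj⟩
    have hs : (Finset.univ.image f).card = n := by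
      rw [Finset.card_image_of_injective _ hinj]; simp
    set s := Finset.univ.image f with hsdef
    have hex : ∀ k, ∃ l, s.orderEmbOfFin hs l = f k := by
      intro k
      have : f k ∈ Set.range (s.orderEmbOfFin hs) := by
        rw [Finset.range_orderEmbOfFin]; simp [hsdef]
      exact this
    choose σ hσ using hex
    have hσi : Function.Injective σ := by
      intro a b hab
      apply hinj
      rw [← hσ, ← hσ, hab]
    refine ⟨⟨⟨Equiv.ofBijective σ (Finite.injective_iff_bijective.1 hσi), ?_⟩, ⟨s, hs⟩⟩, ?_⟩
    · intro j h
      have := hf j h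
      simp only [Equiv.ofBijective_apply]
      by_cases hj : Odd j
      · have hj' : ¬ Even j := by simpa using hj
        rw [if_neg hj']
        rw [if_pos hj, ← hσ, ← hσ, OrderEmbedding.le_iff_le] at this
        refine lt_of_le_of_ne this fun e => ?_
        have := hσi e
        simp at this
      · have hj' : Even j := by simpa using hj
        rw [if_pos hj']
        rw [if_neg hj, ← hσ, ← hσ, OrderEmbedding.le_iff_le] at this
        refine lt_of_le_of_ne this fun e => ?_
        have := hσi e
        simp at this
    · apply Subtype.ext
      funext k
      exact hσ k

lemma zz_bounds (n m : ℕ) : EulerNumber n * m.choose n ≤ zzN n m ∧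
    zzN n m + m.descFactorial n ≤ EulerNumber n * m.choose n + m ^ n := by
  classical
  rw [← zz_inj_count, zzN]
  have hd : m.descFactorial n = (Finset.univ.filter
      (fun f : Fin n → Fin m => Function.Injective f)).card := by
    rw [← Fintype.card_subtype, Fintype.card_congr (Equiv.subtypeInjectiveEquivEmbedding _ _),
      Fintype.card_embedding_eq]
    simp
  have hp : m ^ n = (Finset.univ : Finset (Fin n → Fin m)).card := by simp
  rw [hd, hp, Nat.card_eq_fintype_card, Fintype.card_subtype, Nat.card_eq_fintype_card,
    Fintype.card_subtype]
  refine ⟨Finset.card_le_card (fun f hf => ?_), ?_⟩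
  · simp only [Finset.mem_filter, Finset.mem_univ, true_and] at hf ⊢
    exact hf.1
  · rw [← Finset.card_union_add_card_inter, ← Finset.filter_and, add_comm]
    gcongr
    exact Finset.subset_univ _

open Filter Topology in
lemma zz_limit (n : ℕ) : Tendsto (fun m : ℕ => (zzN n m : ℝ) / (m:ℝ) ^ n) atTop
    (𝓝 ((EulerNumber n : ℝ) / n.factorial)) := by
  have hz : ∀ᶠ (x : ℕ) in atTop, ((x : ℝ)^n) ≠ 0 :=
    eventually_atTop.mpr ⟨1, fun n hn ↦ pow_ne_zero _ (ne_of_gt (mod_cast hn))⟩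
  have h1 := (Asymptotics.isEquivalent_iff_tendsto_one hz).1 (isEquivalent_descFactorial n)
  have h2 : Tendsto (fun m : ℕ => ((EulerNumber n : ℝ) * (m.choose n)) / (m:ℝ) ^ n) atTop
    (𝓝 ((EulerNumber n : ℝ) / n.factorial)) := by
    have := h1.const_mul ((EulerNumber n : ℝ) / n.factorial)
    rw [mul_one] at this
    refine this.congr fun m => ?_
    simp only [Pi.div_apply]
    rw [Nat.descFactorial_eq_factorial_mul_choose]
    push_cast
    have : (n.factorial : ℝ) ≠ 0 := by positivity
    field_simp
  have h3 : Tendsto (fun m : ℕ => ((EulerNumber n : ℝ) * (m.choose n)) / (m:ℝ) ^ n +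
      (1 - (m.descFactorial n : ℝ) / (m:ℝ)^n)) atTop
    (𝓝 ((EulerNumber n : ℝ) / n.factorial)) := by
    have h1' : Tendsto (fun m : ℕ => (m.descFactorial n : ℝ) / (m:ℝ)^n) atTop (𝓝 1) := h1
    simpa using h2.add (h1'.const_sub 1)
  refine tendsto_of_tendsto_of_tendsto_of_le_of_le' h2 h3 (Eventually.of_forall fun m => ?_) ?_
  · have := (zz_bounds n m).1
    have : (EulerNumber n : ℝ) * (m.choose n) ≤ zzN n m := by exact_mod_cast this
    gcongr
  · filter_upwards [hz] with m hm
    have := (zz_bounds n m).2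
    have : (zzN n m : ℝ) + m.descFactorial n ≤ EulerNumber n * m.choose n + (m:ℝ) ^ n := by
      exact_mod_cast this
    have hp : (0:ℝ) < (m:ℝ)^n := lt_of_le_of_ne (by positivity) (Ne.symm hm)
    rw [← sub_nonneg]
    have e : (EulerNumber n : ℝ) * (m.choose n) / (m:ℝ) ^ n +
      (1 - (m.descFactorial n : ℝ) / (m:ℝ)^n) - (zzN n m : ℝ) / (m:ℝ) ^ n =
      ((EulerNumber n : ℝ) * (m.choose n) + (m:ℝ)^n - m.descFactorial n - zzN n m) / (m:ℝ)^n := by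
      field_simp
      ring
    rw [e]
    apply div_nonneg _ hp.le
    linarith

open Filter Topology in
lemma zz_limit_poly (n : ℕ) (b : ℕ → ℝ) (κ : ℝ) (hκ : n = 0 → κ = 0) :
    Tendsto (fun m : ℕ => ((∑ k ∈ Finset.range (n+1), b k * ((m:ℝ) + 1/2) ^ k) - κ) / (m:ℝ) ^ n)
      atTop (𝓝 (b n)) := by
  have hinv : Tendsto (fun m : ℕ => (1:ℝ) / (m:ℝ)) atTop (𝓝 0) := tendsto_one_div_atTop_nhds_zero_nat
  have hone : Tendsto (fun m : ℕ => (1 + (1/2) * ((1:ℝ) / (m:ℝ)))) atTop (𝓝 1) := by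
    have h := (hinv.const_mul (1/2)).const_add 1
    rw [mul_zero, add_zero] at h
    exact h
  have hterm : ∀ k ∈ Finset.range (n+1), Tendsto (fun m : ℕ =>
      b k * ((1 + (1/2) * ((1:ℝ) / (m:ℝ))) ^ k * ((1:ℝ) / (m:ℝ)) ^ (n - k))) atTop
      (𝓝 (b k * (1 ^ k * 0 ^ (n-k)))) := by
    intro k _
    exact ((hone.pow k).mul (hinv.pow (n-k))).const_mul (b k)
  have hsum := tendsto_finsetSum _ hterm
  have hk : Tendsto (fun m : ℕ => κ * ((1:ℝ) / (m:ℝ)) ^ n) atTop (𝓝 (κ * 0 ^ n)) :=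
    (hinv.pow n).const_mul κ
  have hk0 : κ * 0 ^ n = 0 := by
    rcases Nat.eq_zero_or_pos n with h | h
    · simp [hκ h]
    · simp [h.ne']
  have hs0 : ∑ k ∈ Finset.range (n+1), b k * ((1:ℝ) ^ k * 0 ^ (n-k)) = b n := by
    rw [Finset.sum_range_succ, Finset.sum_eq_zero]
    · simp
    · intro k hk
      simp only [Finset.mem_range] at hk
      have : n - k ≠ 0 := by omega
      simp [this]
  have := hsum.sub hk
  rw [hk0, hs0, sub_zero] at this
  refine this.congr' ?_
  filter_upwards [eventually_gt_atTop 0] with m hm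
  have hm' : (m:ℝ) ≠ 0 := by exact_mod_cast hm.ne'
  rw [sub_div, Finset.sum_div]
  congr 1
  · apply Finset.sum_congr rfl
    intro k hk
    simp only [Finset.mem_range] at hk
    have : (m:ℝ)^n = (m:ℝ)^k * (m:ℝ)^(n-k) := by rw [← pow_add]; congr 1; omega
    rw [this]
    have e : 1 + (1/2) * ((1:ℝ) / (m:ℝ)) = ((m:ℝ) + 1/2) / m := by field_simp
    rw [e, div_pow, div_pow, one_pow]
    field_simp
  · rw [div_pow, one_pow]; ring

lemma zz_coeff (a : ℕ → ℝ) (ha : ∀ m n : ℕ, 0 < m → (zzN n m : ℝ) =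
    (∑ k ∈ Finset.range (n+1), a k * zzTc n (zzGm k) * ((m:ℝ) + 1/2) ^ k)
      - if n = 1 then 1/2 else 0) (n : ℕ) : a n = (EulerNumber n : ℝ) / n.factorial := by
  have h1 := zz_limit_poly n (fun k => a k * zzTc n (zzGm k)) (if n = 1 then 1/2 else 0)
    (by rintro rfl; simp)
  have h2 := zz_limit n
  simp only [zz_gamma_diag, mul_one] at h1
  refine tendsto_nhds_unique (h1.congr' ?_) h2
  filter_upwards [Filter.eventually_gt_atTop 0] with m hm
  rw [ha m n hm]

/-- for `n ≥ 2` and every real `t`,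
`Ω(Z_n; t − 1/2) = Σ_{k=0}^n (E_k/k!)·γ_{n,k}·t^k`. -/
theorem zigzag_shifted_eq_gamma_sum (Ω : ℕ → Polynomial ℚ)
    (hΩ : ∀ m t : ℕ, 0 < t →
      (Ω m).eval (t : ℚ) = (Nat.card {f : Fin m → Fin t // ZigzagMono m t f} : ℚ))
    (n : ℕ) (hn : 2 ≤ n) (t : ℝ) :
    Polynomial.aeval (t - 1 / 2 : ℝ) (Ω n) =
      ∑ k ∈ Finset.range (n + 1),
        (EulerNumber k : ℝ) / (k.factorial : ℝ) * gammaCoef n k * t ^ k := by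
  obtain ⟨a, ha⟩ := zz_count
  have hcoef := zz_coeff a ha
  let P : Polynomial ℝ := (Ω n).map (algebraMap ℚ ℝ)
  let Q : Polynomial ℝ := ∑ k ∈ Finset.range (n + 1),
    Polynomial.C ((EulerNumber k : ℝ) / (k.factorial : ℝ) * gammaCoef n k) *
      (Polynomial.X + Polynomial.C (1/2)) ^ k
  have hQ : ∀ x, Q.eval x = ∑ k ∈ Finset.range (n + 1),
      (EulerNumber k : ℝ) / (k.factorial : ℝ) * gammaCoef n k * (x + 1/2) ^ k := by
    intro x
    simp only [Q, Polynomial.eval_finsetSum, Polynomial.eval_mul, Polynomial.eval_C,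
      Polynomial.eval_pow, Polynomial.eval_add, Polynomial.eval_X]
  have hPQ : P = Q := by
    apply Polynomial.eq_of_infinite_eval_eq
    refine Set.Infinite.mono (s := Set.range fun m : ℕ => ((m + 1 : ℕ) : ℝ)) ?_ ?_
    · rintro _ ⟨m, rfl⟩
      simp only [Set.mem_ofPred_eq]
      have h1 := ha (m+1) n (by omega)
      rw [if_neg (by omega), sub_zero] at h1
      have h2 := hΩ n (m+1) (by omega)
      have h3 : P.eval ((m + 1 : ℕ) : ℝ) = (zzN n (m+1) : ℝ) := by
        have : ((m + 1 : ℕ) : ℝ) = algebraMap ℚ ℝ ((m+1 : ℕ) : ℚ) := by simp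
        rw [this, Polynomial.eval_map_algebraMap, Polynomial.aeval_algebraMap_apply]
        change algebraMap ℚ ℝ ((Ω n).eval _) = _
        rw [h2, zzN]; simp
      rw [h3, h1, hQ]
      apply Finset.sum_congr rfl
      intro k _
      rw [hcoef, zz_gammaCoef]
    · apply Set.infinite_range_of_injective
      intro x y h
      simpa using h
  have := hQ (t - 1/2)
  rw [← hPQ, Polynomial.eval_map_algebraMap, sub_add_cancel] at this
  exact this
end
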